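/- Let T be an infinite, locally finite rooted tree with root o and no leaves except possibly o, with interaction strengths J_v satisfying 0 < J_min ≤ J_v ≤ J_max and inverse temperature β > 0; set θ_v = tanh(β J_v). Assign to the edge from the parent of v to v the resistance R_v = Π_{o < y ≤ v} θ_y^{-2}. Then, under the spin-glass measures P^(N,sg), the boundary log-likelihood ratio X_o^(N) at the root converges in law to 0 as N → ∞ if and only if cap_2(T) = 0. -/

import Mathlib

open scoped ENNReal Classical

noncomputable section

/-- Vertices of the canonical rooted tree: finite sequences of naturals; the root is `[]`. -/
abbrev Vtx := List ℕ

/-- Vertices of the tree determined by the child-count function `c`. -/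
inductive IsVtx (c : Vtx → ℕ) : Vtx → Prop
  | root : IsVtx c []
  | child {v : Vtx} {i : ℕ} : IsVtx c v → i < c v → IsVtx c (v ++ [i])

/-- A flow: conservation at every non-root, non-leaf vertex (edges are identified with their
lower endpoints). -/
def IsFlow (c : Vtx → ℕ) (μ : Vtx → ℝ≥0∞) : Prop :=
  ∀ v : Vtx, IsVtx c v → v ≠ [] → c v ≠ 0 →
    μ v = ∑ i ∈ Finset.range (c v), μ (v ++ [i])

/-- Total flow out of the root. -/
def flowMass (c : Vtx → ℕ) (μ : Vtx → ℝ≥0∞) : ℝ≥0∞ :=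
  ∑ i ∈ Finset.range (c []), μ [i]

/-- An infinite ray from the root. -/
def IsRay (c : Vtx → ℕ) (y : ℕ → ℕ) : Prop :=
  ∀ n : ℕ, y n < c ((List.range n).map y)

/-- `V_μ(y) = Σ_{e ∈ y} (μ(e) R(e))^s` along an infinite ray. -/
def rayPot (μ R : Vtx → ℝ≥0∞) (s : ℝ) (y : ℕ → ℕ) : ℝ≥0∞ :=
  ∑' n : ℕ, (μ ((List.range (n + 1)).map y) * R ((List.range (n + 1)).map y)) ^ s

/-- `V_μ` along the maximal path from the root to a leaf `ℓ`. -/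
def leafPot (μ R : Vtx → ℝ≥0∞) (s : ℝ) (ℓ : Vtx) : ℝ≥0∞ :=
  ∑ k ∈ Finset.range ℓ.length, (μ (ℓ.take (k + 1)) * R (ℓ.take (k + 1))) ^ s

/-- `cap_p` of an infinite leafless tree. -/
def capInf (c : Vtx → ℕ) (R : Vtx → ℝ≥0∞) (p : ℝ) : ℝ≥0∞ :=
  sSup {m | ∃ μ : Vtx → ℝ≥0∞, IsFlow c μ ∧
    (∀ y : ℕ → ℕ, IsRay c y → rayPot μ R (p - 1) y ≤ 1) ∧ m = flowMass c μ}

/-- `cap_p` of a finite tree. -/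
def capFin (c : Vtx → ℕ) (R : Vtx → ℝ≥0∞) (p : ℝ) : ℝ≥0∞ :=
  sSup {m | ∃ μ : Vtx → ℝ≥0∞, IsFlow c μ ∧
    (∀ ℓ : Vtx, IsVtx c ℓ → c ℓ = 0 → leafPot μ R (p - 1) ℓ ≤ 1) ∧ m = flowMass c μ}

/-- The set of vertices at distance `n` from the root. -/
def lev (c : Vtx → ℕ) : ℕ → Finset Vtx
  | 0 => {([] : Vtx)}
  | n + 1 => (lev c n).biUnion fun v => (Finset.range (c v)).image fun i => v ++ [i]

/-- The vertices of the truncated tree `T^(N)`. -/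
def verts (c : Vtx → ℕ) (N : ℕ) : Finset Vtx := (Finset.range (N + 1)).biUnion (lev c)

/-- Spin configurations on `T^(N)`. -/
def Conf (c : Vtx → ℕ) (N : ℕ) := {v // v ∈ verts c N} → Bool

instance (c : Vtx → ℕ) (N : ℕ) : Fintype (Conf c N) := by unfold Conf; infer_instance

/-- The ±1 spin of a configuration at a vertex. -/
def spin (c : Vtx → ℕ) (N : ℕ) (σ : Conf c N) (w : Vtx) : ℝ :=
  if h : w ∈ verts c N then (if σ ⟨w, h⟩ then 1 else -1) else 1

/-- The weight `W(η) = Π_{v → w} exp(β J_w η(v) η(w))` of a configuration on `T^(N)`. -/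
def wt (c : Vtx → ℕ) (J : Vtx → ℝ) (β : ℝ) (N : ℕ) (σ : Conf c N) : ℝ :=
  ∏ w ∈ (Finset.range N).biUnion (fun n => lev c (n + 1)),
    Real.exp (β * J w * spin c N σ w.dropLast * spin c N σ w)

/-- `P^(N,+)(η(o) = +1)`: probability of a plus spin at the root under plus boundary
conditions at level `N`. -/
def plusProb (c : Vtx → ℕ) (J : Vtx → ℝ) (β : ℝ) (N : ℕ) : ℝ :=
  (∑ σ : Conf c N, if (∀ x : {v // v ∈ verts c N}, x.1 ∈ lev c N → σ x = true)
      ∧ spin c N σ [] = 1 then wt c J β N σ else 0) /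
  (∑ σ : Conf c N, if (∀ x : {v // v ∈ verts c N}, x.1 ∈ lev c N → σ x = true)
      then wt c J β N σ else 0)

/-- `X_o^(N)`: the log-likelihood ratio of plus to minus at the root, given the boundary
configuration induced by `σ` on level `N` (a function of the boundary of `σ` only). -/
def XoOf (c : Vtx → ℕ) (J : Vtx → ℝ) (β : ℝ) (N : ℕ) (σ : Conf c N) : ℝ :=
  Real.log
    ((∑ τ : Conf c N, if (∀ x : {v // v ∈ verts c N}, x.1 ∈ lev c N → τ x = σ x)
        ∧ spin c N τ [] = 1 then wt c J β N τ else 0) /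
     (∑ τ : Conf c N, if (∀ x : {v // v ∈ verts c N}, x.1 ∈ lev c N → τ x = σ x)
        ∧ spin c N τ [] = -1 then wt c J β N τ else 0))

/-- The message passed along an edge of interaction `b` by a vertex whose log-likelihood ratio is
`x`. -/
def edgeMsg (b x : ℝ) : ℝ := Real.log (Real.cosh (b + x / 2) / Real.cosh (b - x / 2))

lemma edgeMsg_zero (b : ℝ) : edgeMsg b 0 = 0 := by
  simp [edgeMsg, (Real.cosh_pos b).ne']

lemma edgeMsg_neg (b x : ℝ) : edgeMsg b (-x) = -edgeMsg b x := by
  unfold edgeMsg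
  rw [← Real.log_inv, inv_div]
  congr 3 <;> ring_nf

lemma edgeMsg_abs_sq (b x : ℝ) : edgeMsg b |x| ^ 2 = edgeMsg b x ^ 2 := by
  rcases abs_choice x with h | h <;> rw [h]
  rw [edgeMsg_neg, neg_sq]

lemma hasDerivAt_edgeMsg (b x : ℝ) :
    HasDerivAt (edgeMsg b) (Real.sinh (2 * b) / (Real.cosh (2 * b) + Real.cosh x)) x := by
  have e : edgeMsg b = fun x =>
      Real.log (Real.cosh (b + x / 2)) - Real.log (Real.cosh (b - x / 2)) := by
    funext y
    rw [edgeMsg, Real.log_div (Real.cosh_pos _).ne' (Real.cosh_pos _).ne']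
  have h1 : HasDerivAt (fun y : ℝ => b + y / 2) (1 / 2) x :=
    ((hasDerivAt_id x).div_const 2).const_add b
  have h2 : HasDerivAt (fun y : ℝ => b - y / 2) (-(1 / 2)) x :=
    ((hasDerivAt_id x).div_const 2).const_sub b
  rw [e]
  refine ((h1.cosh.log (Real.cosh_pos _).ne').sub
    (h2.cosh.log (Real.cosh_pos _).ne')).congr_deriv ?_
  have p1 := Real.cosh_pos (b + x / 2)
  have p2 := Real.cosh_pos (b - x / 2)
  have e1 : Real.sinh (2 * b) = Real.sinh (b + x / 2) * Real.cosh (b - x / 2)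
      + Real.cosh (b + x / 2) * Real.sinh (b - x / 2) := by
    rw [← Real.sinh_add]; ring_nf
  have e2 : Real.cosh (2 * b) + Real.cosh x
      = 2 * (Real.cosh (b + x / 2) * Real.cosh (b - x / 2)) := by
    have a1 : Real.cosh (2 * b) = Real.cosh ((b + x / 2) + (b - x / 2)) := by ring_nf
    have a2 : Real.cosh x = Real.cosh ((b + x / 2) - (b - x / 2)) := by ring_nf
    rw [a1, a2, Real.cosh_add (b + x / 2), Real.cosh_sub (b + x / 2)]; ring
  rw [e1, e2]
  field_simp
  ring

lemma continuous_edgeMsg (b : ℝ) : Continuous (edgeMsg b) :=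
  continuous_iff_continuousAt.2 fun x => (hasDerivAt_edgeMsg b x).continuousAt

lemma monotone_edgeMsg {b : ℝ} (hb : 0 < b) : Monotone (edgeMsg b) := by
  refine monotone_of_deriv_nonneg (fun x => (hasDerivAt_edgeMsg b x).differentiableAt) fun x => ?_
  rw [(hasDerivAt_edgeMsg b x).deriv]
  have := Real.sinh_pos_iff.2 (show 0 < 2 * b by linarith)
  have := Real.cosh_pos (2 * b)
  have := Real.cosh_pos x
  positivity

lemma edgeMsg_nonneg {b x : ℝ} (hb : 0 < b) (hx : 0 ≤ x) : 0 ≤ edgeMsg b x :=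
  edgeMsg_zero b ▸ monotone_edgeMsg hb hx

lemma edgeMsg_abs_le {b : ℝ} (hb : 0 < b) (x : ℝ) : |edgeMsg b x| ≤ 2 * b := by
  have key : ∀ y, edgeMsg b y ≤ 2 * b := fun y => by
    unfold edgeMsg
    have h1 := Real.cosh_pos (b + y / 2)
    have h2 := Real.cosh_pos (b - y / 2)
    rw [Real.log_le_iff_le_exp (by positivity),
      div_le_iff₀ (Real.cosh_pos _), Real.cosh_eq, Real.cosh_eq]
    have e1 : Real.exp (2 * b) * ((Real.exp (b - y / 2) + Real.exp (-(b - y / 2))) / 2)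
        = (Real.exp (3 * b - y / 2) + Real.exp (b + y / 2)) / 2 := by
      rw [mul_div_assoc', mul_add, ← Real.exp_add, ← Real.exp_add]; ring_nf
    have : Real.exp (-(b + y / 2)) ≤ Real.exp (3 * b - y / 2) := Real.exp_le_exp.2 (by linarith)
    rw [e1]; linarith
  rw [abs_le]
  have := key (-x)
  rw [edgeMsg_neg] at this
  exact ⟨by linarith, key x⟩

lemma concaveOn_edgeMsg {b : ℝ} (hb : 0 < b) : ConcaveOn ℝ (Set.Ici 0) (edgeMsg b) := by
  refine AntitoneOn.concaveOn_of_deriv (convex_Ici 0) (continuous_edgeMsg b).continuousOn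
    (fun x _ => (hasDerivAt_edgeMsg b x).differentiableAt.differentiableWithinAt) ?_
  rw [interior_Ici]
  intro x hx y hy hxy
  rw [(hasDerivAt_edgeMsg b x).deriv, (hasDerivAt_edgeMsg b y).deriv]
  have h1 := Real.sinh_pos_iff.2 (show 0 < 2 * b by linarith)
  have h2 := Real.cosh_pos (2 * b)
  have h3 := Real.cosh_pos x
  have h4 : Real.cosh x ≤ Real.cosh y := by
    rw [Real.cosh_le_cosh, abs_of_pos hx, abs_of_pos hy]; exact hxy
  gcongr

lemma mul_edgeMsg_le {b x y : ℝ} (hb : 0 < b) (hx : 0 ≤ x) (hxy : x ≤ y) :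
    x * edgeMsg b y ≤ y * edgeMsg b x := by
  rcases hx.eq_or_lt with rfl | hx
  · simp [edgeMsg_zero]
  have hy : 0 < y := hx.trans_le hxy
  have h := (concaveOn_edgeMsg hb).2 (Set.mem_Ici.2 le_rfl) (Set.mem_Ici.2 hy.le)
    (show 0 ≤ 1 - x / y by rw [sub_nonneg, div_le_one hy]; exact hxy)
    (show 0 ≤ x / y by positivity) (by ring)
  simp only [smul_eq_mul, edgeMsg_zero, mul_zero, zero_add] at h
  rw [div_mul_cancel₀ _ hy.ne', div_mul_eq_mul_div, div_le_iff₀ hy] at h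
  linarith

lemma tanh_eq_sinh_two_mul_div (b : ℝ) :
    Real.tanh b = Real.sinh (2 * b) / (1 + Real.cosh (2 * b)) := by
  have := Real.cosh_pos b
  have h : 1 + Real.cosh (2 * b) = 2 * Real.cosh b ^ 2 := by
    rw [Real.cosh_two_mul]; linarith [Real.cosh_sq b]
  rw [h, Real.tanh_eq_sinh_div_cosh, Real.sinh_two_mul]
  field_simp

lemma le_edgeMsg {b x : ℝ} (hb : 0 < b) (hx : 0 ≤ x) (hx1 : x ≤ 1) :
    Real.tanh b * x ≤ (1 + x ^ 2 / 2) * edgeMsg b x := by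
  rcases hx.eq_or_lt with rfl | hx
  · simp [edgeMsg_zero]
  obtain ⟨z, hz, he⟩ := exists_hasDerivAt_eq_slope (edgeMsg b) _ hx
    (continuous_edgeMsg b).continuousOn (fun y _ => hasDerivAt_edgeMsg b y)
  rw [edgeMsg_zero, sub_zero, sub_zero, eq_div_iff hx.ne'] at he
  rw [← he, tanh_eq_sinh_two_mul_div]
  have h1 := Real.sinh_pos_iff.2 (show 0 < 2 * b by linarith)
  have h2 := Real.one_le_cosh (2 * b)
  have h3 := Real.cosh_pos z
  have h4 : Real.cosh z ≤ Real.cosh x := by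
    rw [Real.cosh_le_cosh, abs_of_pos hz.1, abs_of_pos hx]; exact hz.2.le
  have h5 : Real.cosh x ≤ 1 + x ^ 2 := by
    refine (Real.cosh_le_exp_half_sq x).trans ?_
    have h6 : x ^ 2 ≤ 1 := by nlinarith
    have h7 := Real.exp_bound_div_one_sub_of_interval (x := x ^ 2 / 2) (by positivity) (by linarith)
    refine h7.trans ?_
    rw [div_le_iff₀ (by linarith)]
    nlinarith [sq_nonneg x]
  rw [← mul_assoc, mul_div_assoc']
  refine mul_le_mul_of_nonneg_right ?_ hx.le
  rw [div_le_div_iff₀ (by linarith) (by linarith)]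
  have : Real.cosh (2 * b) + Real.cosh z ≤ (1 + x ^ 2 / 2) * (1 + Real.cosh (2 * b)) := by
    nlinarith [sq_nonneg x]
  nlinarith

lemma tanh_pos {b : ℝ} (hb : 0 < b) : 0 < Real.tanh b := by
  rw [Real.tanh_eq_sinh_div_cosh]
  exact div_pos (Real.sinh_pos_iff.2 hb) (Real.cosh_pos b)

/-- Lower bound for the squared message, uniform in the interaction. -/
lemma le_edgeMsg_sq {b : ℝ} (hb : 0 < b) (x : ℝ) :
    Real.tanh b ^ 2 * x ^ 2 ≤ edgeMsg b x ^ 2 * (1 + 3 * x ^ 2) := by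
  rw [← edgeMsg_abs_sq, ← sq_abs x]
  have hx := abs_nonneg x
  generalize |x| = x at hx
  have ht := tanh_pos hb
  have hg := edgeMsg_nonneg hb hx
  rcases le_total x 1 with h1 | h1
  · have h2 := le_edgeMsg hb hx h1
    have h3 : (Real.tanh b * x) ^ 2 ≤ ((1 + x ^ 2 / 2) * edgeMsg b x) ^ 2 :=
      pow_le_pow_left₀ (by positivity) h2 2
    have h4 : (1 + x ^ 2 / 2) ^ 2 ≤ 1 + 3 * x ^ 2 := by
      have : x ^ 2 ≤ 1 := pow_le_one₀ hx h1
      nlinarith [sq_nonneg x]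
    calc _ = (Real.tanh b * x) ^ 2 := by ring
      _ ≤ _ := h3
      _ = edgeMsg b x ^ 2 * (1 + x ^ 2 / 2) ^ 2 := by ring
      _ ≤ _ := by gcongr
  · have h2 := le_edgeMsg hb zero_le_one le_rfl
    have h3 := monotone_edgeMsg hb h1
    have h4 : Real.tanh b ≤ 3 / 2 * edgeMsg b x := by linarith
    have h5 : Real.tanh b ^ 2 ≤ (3 / 2 * edgeMsg b x) ^ 2 := pow_le_pow_left₀ ht.le h4 2
    nlinarith [sq_nonneg x, sq_nonneg (edgeMsg b x), mul_nonneg (sq_nonneg x) (sub_nonneg.2 h5)]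

lemma one_add_half_sq_add_le_cosh (x : ℝ) : 1 + x ^ 2 / 2 + x ^ 4 / 24 ≤ Real.cosh x := by
  have h := Real.hasSum_cosh x
  have := h.summable.sum_le_tsum (Finset.range 3) (fun i _ => by
    have : 0 ≤ x ^ (2 * i) := by rw [pow_mul]; positivity
    positivity)
  rw [h.tsum_eq] at this
  simpa [Finset.sum_range_succ, Nat.factorial] using this

/-- Upper bound for the squared message, uniform over bounded interactions. -/
lemma edgeMsg_sq_le {b M : ℝ} (hb : 0 < b) (hM : 1 + Real.cosh (2 * b) ≤ M) (x : ℝ) :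
    edgeMsg b x ^ 2 * (1 + 1 / (4 * M) * x ^ 2) ≤ Real.tanh b ^ 2 * x ^ 2 := by
  rw [← edgeMsg_abs_sq, ← sq_abs x]
  have hx := abs_nonneg x
  generalize |x| = x at hx
  have ht := tanh_pos hb
  have hg := edgeMsg_nonneg hb hx
  have hc := Real.one_le_cosh (2 * b)
  have hM0 : 2 ≤ M := by linarith
  set κ : ℝ := 1 / (4 * M) with hκ
  have hκ0 : 0 < κ := by positivity
  have pos : ∀ y : ℝ, 0 < 1 + κ * y ^ 2 := fun y => by positivity
  have hd : ∀ y : ℝ, HasDerivAt (fun y => Real.tanh b * (y / √(1 + κ * y ^ 2)) - edgeMsg b y)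
      (Real.tanh b * (1 / ((1 + κ * y ^ 2) * √(1 + κ * y ^ 2)))
        - Real.sinh (2 * b) / (Real.cosh (2 * b) + Real.cosh y)) y := by
    intro y
    have s := Real.sqrt_pos.2 (pos y)
    have ss := Real.sq_sqrt (pos y).le
    have h1 : HasDerivAt (fun y : ℝ => 1 + κ * y ^ 2) (κ * (2 * y)) y := by
      simpa using ((hasDerivAt_pow 2 y).const_mul κ).const_add 1
    refine ((((hasDerivAt_id y).div (h1.sqrt (pos y).ne') s.ne').const_mul _).sub
      (hasDerivAt_edgeMsg b y)).congr_deriv ?_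
    congr 2
    rw [ss]
    simp only [id]
    have := pos y
    field_simp
    rw [ss]
    ring
  have hmono : MonotoneOn (fun y => Real.tanh b * (y / √(1 + κ * y ^ 2)) - edgeMsg b y)
      (Set.Ici 0) := by
    refine monotoneOn_of_deriv_nonneg (convex_Ici 0)
      (fun y _ => (hd y).continuousAt.continuousWithinAt)
      (fun y _ => (hd y).differentiableAt.differentiableWithinAt) ?_
    intro y _
    rw [(hd y).deriv, sub_nonneg, tanh_eq_sinh_two_mul_div, div_mul_div_comm, mul_one]
    have h1 := Real.sinh_pos_iff.2 (show 0 < 2 * b by linarith)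
    have s := Real.sqrt_pos.2 (pos y)
    have ss := Real.sq_sqrt (pos y).le
    have := pos y
    refine div_le_div_of_nonneg_left h1.le (by positivity) ?_
    have hy := one_add_half_sq_add_le_cosh y
    have h2 : (1 + κ * y ^ 2) * √(1 + κ * y ^ 2) ≤ 1 + 1 / M * (y ^ 2 / 2 + y ^ 4 / 24) := by
      refine abs_le_of_sq_le_sq' ?_ (by positivity) |>.2
      rw [mul_pow, ss, ← pow_succ]
      have e : 1 / M = 4 * κ := by rw [hκ]; field_simp
      rw [e]
      have hk : κ ≤ 1 / 8 := by
        rw [hκ]; exact one_div_le_one_div_of_le (by norm_num) (by linarith)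
      have : (1 + 4 * κ * (y ^ 2 / 2 + y ^ 4 / 24)) ^ 2 - (1 + κ * y ^ 2) ^ (2 + 1) =
        κ * y ^ 2 + κ * y ^ 4 * (1 / 3 + κ) + κ ^ 2 * y ^ 6 * (2 / 3 - κ)
          + κ ^ 2 * y ^ 8 / 36 := by ring
      have p : 0 ≤ 2 / 3 - κ := by linarith
      have : 0 ≤ κ * y ^ 2 + κ * y ^ 4 * (1 / 3 + κ) + κ ^ 2 * y ^ 6 * (2 / 3 - κ)
          + κ ^ 2 * y ^ 8 / 36 := by
        have := Even.pow_nonneg (show Even 6 by decide) y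
        positivity
      linarith
    have h3 : 1 / M * (y ^ 2 / 2 + y ^ 4 / 24) ≤
        1 / (1 + Real.cosh (2 * b)) * (Real.cosh y - 1) := by
      gcongr
      linarith
    calc Real.cosh (2 * b) + Real.cosh y
        = (1 + Real.cosh (2 * b)) * (1 + 1 / (1 + Real.cosh (2 * b)) * (Real.cosh y - 1)) := by
          field_simp; ring
      _ ≥ _ := by gcongr; linarith
  have h := hmono (Set.mem_Ici.2 le_rfl) (Set.mem_Ici.2 hx) hx
  simp only [edgeMsg_zero, zero_div, mul_zero, sub_zero, sub_nonneg] at h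
  have s := Real.sqrt_pos.2 (pos x)
  have ss := Real.sq_sqrt (pos x).le
  rw [mul_div_assoc', le_div_iff₀ s] at h
  have := pow_le_pow_left₀ (by positivity) h 2
  rw [mul_pow, ss, mul_pow] at this
  exact this

lemma edgeMsg_sq_order {b : ℝ} (hb : 0 < b) (x y : ℝ) :
    (edgeMsg b x ^ 2 - edgeMsg b y ^ 2) * (edgeMsg b x ^ 2 * y ^ 2 - x ^ 2 * edgeMsg b y ^ 2) ≤ 0 ∧
    (x ^ 2 - y ^ 2) * (edgeMsg b x ^ 2 * y ^ 2 - x ^ 2 * edgeMsg b y ^ 2) ≤ 0 := by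
  have main : ∀ x y : ℝ, 0 ≤ x → x ≤ y →
      edgeMsg b x ^ 2 ≤ edgeMsg b y ^ 2 ∧ x ^ 2 ≤ y ^ 2 ∧
      x ^ 2 * edgeMsg b y ^ 2 ≤ edgeMsg b x ^ 2 * y ^ 2 := fun x y hx hxy => by
    have hgx := edgeMsg_nonneg hb hx
    have hgy := edgeMsg_nonneg hb (hx.trans hxy)
    refine ⟨pow_le_pow_left₀ hgx (monotone_edgeMsg hb hxy) 2, pow_le_pow_left₀ hx hxy 2, ?_⟩
    have := pow_le_pow_left₀ (by positivity) (mul_edgeMsg_le hb hx hxy) 2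
    linarith [mul_pow x (edgeMsg b y) 2, mul_pow y (edgeMsg b x) 2]
  rw [← edgeMsg_abs_sq b x, ← edgeMsg_abs_sq b y, ← sq_abs x, ← sq_abs y]
  rcases le_total |x| |y| with h | h
  · obtain ⟨h1, h2, h3⟩ := main _ _ (abs_nonneg x) h
    constructor <;> nlinarith
  · obtain ⟨h1, h2, h3⟩ := main _ _ (abs_nonneg y) h
    constructor <;> nlinarith

lemma tanh_sq_le_one (b : ℝ) : Real.tanh b ^ 2 ≤ 1 := by
  have := Real.cosh_pos b
  rw [Real.tanh_eq_sinh_div_cosh, div_pow, div_le_one (by positivity)]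
  linarith [Real.cosh_sq b]

lemma edgeMsg_sq_le_sq {b : ℝ} (hb : 0 < b) (x : ℝ) : edgeMsg b x ^ 2 ≤ x ^ 2 := by
  have h := edgeMsg_sq_le hb le_rfl x
  have hc := Real.one_le_cosh (2 * b)
  have : 0 ≤ 1 / (4 * (1 + Real.cosh (2 * b))) * x ^ 2 := by positivity
  nlinarith [sq_nonneg x, sq_nonneg (edgeMsg b x), tanh_sq_le_one b]

lemma tanh_sq_le {b : ℝ} (hb : 0 < b) : Real.tanh b ^ 2 ≤ 9 * (2 * b) ^ 2 := by
  have h1 := le_edgeMsg hb zero_le_one le_rfl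
  have h2 := (le_abs_self _).trans (edgeMsg_abs_le hb 1)
  nlinarith [tanh_pos hb]

lemma le_tanh_sq {b M : ℝ} (hb : 0 < b) (hM : 1 + Real.cosh (2 * b) ≤ M) :
    1 / (4 * M) * (2 * b) ^ 2 ≤ Real.tanh b ^ 2 := by
  have hc := Real.cosh_pos b
  have hs : b ≤ Real.sinh b := Real.self_le_sinh_iff.2 hb.le
  have e : 1 + Real.cosh (2 * b) = 2 * Real.cosh b ^ 2 := by
    rw [Real.cosh_two_mul]; linarith [Real.cosh_sq b]
  rw [Real.tanh_eq_sinh_div_cosh, div_pow, one_div_mul_eq_div,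
    div_le_div_iff₀ (by nlinarith) (by positivity)]
  nlinarith [mul_le_mul_of_nonneg_left (pow_le_pow_left₀ hb.le hs 2) (sq_nonneg (Real.cosh b)),
    sq_nonneg (Real.sinh b), mul_nonneg (sq_nonneg (Real.sinh b)) (sub_nonneg.2 (e ▸ hM))]

section Moments

open Finset BigOperators

variable {Ω : Type*} [Fintype Ω]

lemma edgeMsg_second_moment_le [Nonempty Ω] {b M : ℝ} (hb : 0 < b) (hM : 1 + Real.cosh (2 * b) ≤ M)
    (X : Ω → ℝ) :
    𝔼 σ, edgeMsg b (X σ) ^ 2 ≤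
      Real.tanh b ^ 2 * ((𝔼 σ, X σ ^ 2) / (1 + 1 / (4 * M) * 𝔼 σ, X σ ^ 2)) := by
  have hc := Real.one_le_cosh (2 * b)
  set κ : ℝ := 1 / (4 * M)
  have hκ0 : 0 ≤ κ := by
    have : 0 < M := by linarith
    positivity
  set u := 𝔼 σ, X σ ^ 2 with hu
  have hu0 : 0 ≤ u := expect_nonneg fun _ _ => sq_nonneg _
  have pu : 0 < 1 + κ * u := by positivity
  have hp : ∀ σ, edgeMsg b (X σ) ^ 2 ≤
      Real.tanh b ^ 2 * ((1 + κ * u) ^ 2)⁻¹ * (X σ ^ 2 + κ * u ^ 2) := by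
    intro σ
    have h := edgeMsg_sq_le hb hM (X σ)
    have pz : 0 < 1 + κ * X σ ^ 2 := by positivity
    rw [← le_div_iff₀ pz] at h
    refine h.trans ?_
    rw [mul_assoc, mul_div_assoc]
    refine mul_le_mul_of_nonneg_left ?_ (sq_nonneg _)
    rw [inv_mul_eq_div, div_le_div_iff₀ pz (by positivity)]
    nlinarith [mul_nonneg hκ0 (sq_nonneg (X σ ^ 2 - u))]
  calc _ ≤ 𝔼 σ, Real.tanh b ^ 2 * ((1 + κ * u) ^ 2)⁻¹ * (X σ ^ 2 + κ * u ^ 2) :=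
        expect_le_expect fun σ _ => hp σ
    _ = Real.tanh b ^ 2 * ((1 + κ * u) ^ 2)⁻¹ * (u + κ * u ^ 2) := by
        rw [← mul_expect, expect_add_distrib, Fintype.expect_const]
    _ = _ := by field_simp

lemma le_edgeMsg_second_moment {b : ℝ} (hb : 0 < b) (X : Ω → ℝ)
    (h4 : 𝔼 σ, X σ ^ 4 ≤ 3 * (𝔼 σ, X σ ^ 2) ^ 2) :
    Real.tanh b ^ 2 * ((𝔼 σ, X σ ^ 2) / (1 + 9 * 𝔼 σ, X σ ^ 2)) ≤ 𝔼 σ, edgeMsg b (X σ) ^ 2 := by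
  set u := 𝔼 σ, X σ ^ 2 with hu
  have hu0 : 0 ≤ u := expect_nonneg fun _ _ => sq_nonneg _
  have pu : 0 < 1 + 9 * u := by positivity
  set t := (1 + 9 * u)⁻¹ with ht
  have hp : ∀ σ, Real.tanh b ^ 2 * ((2 * t - t ^ 2) * X σ ^ 2 - 3 * t ^ 2 * X σ ^ 4) ≤
      edgeMsg b (X σ) ^ 2 := by
    intro σ
    have h := le_edgeMsg_sq hb (X σ)
    have pz : 0 < 1 + 3 * X σ ^ 2 := by positivity
    rw [← div_le_iff₀ pz] at h
    refine le_trans ?_ h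
    rw [mul_div_assoc]
    refine mul_le_mul_of_nonneg_left ?_ (sq_nonneg _)
    rw [le_div_iff₀ pz]
    nlinarith [mul_nonneg (sq_nonneg (X σ)) (sq_nonneg (1 - t * (1 + 3 * X σ ^ 2)))]
  calc _ ≤ Real.tanh b ^ 2 * ((2 * t - t ^ 2) * u - 3 * t ^ 2 * 𝔼 σ, X σ ^ 4) := by
        refine mul_le_mul_of_nonneg_left ?_ (sq_nonneg _)
        have e : u / (1 + 9 * u) = (2 * t - t ^ 2) * u - 3 * t ^ 2 * (3 * u ^ 2) := by
          rw [ht]; field_simp; ring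
        rw [e]
        have := mul_le_mul_of_nonneg_left h4 (show 0 ≤ 3 * t ^ 2 by positivity)
        linarith
    _ = 𝔼 σ, Real.tanh b ^ 2 * ((2 * t - t ^ 2) * X σ ^ 2 - 3 * t ^ 2 * X σ ^ 4) := by
        rw [← mul_expect, expect_sub_distrib, ← mul_expect, ← mul_expect]
    _ ≤ _ := expect_le_expect fun σ _ => hp σ

lemma edgeMsg_fourth_moment_le {b : ℝ} (hb : 0 < b) (X : Ω → ℝ)
    (h4 : 𝔼 σ, X σ ^ 4 ≤ 3 * (𝔼 σ, X σ ^ 2) ^ 2) :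
    𝔼 σ, edgeMsg b (X σ) ^ 4 ≤ 3 * (𝔼 σ, edgeMsg b (X σ) ^ 2) ^ 2 := by
  set u : Ω → ℝ := fun σ => X σ ^ 2 with hu
  set h : Ω → ℝ := fun σ => edgeMsg b (X σ) ^ 2 with hh
  have e4 : 𝔼 σ, X σ ^ 4 = 𝔼 σ, u σ * u σ := expect_congr rfl fun σ _ => by simp only [hu]; ring
  have e4' : 𝔼 σ, edgeMsg b (X σ) ^ 4 = 𝔼 σ, h σ * h σ :=
    expect_congr rfl fun σ _ => by simp only [hh]; ring
  rw [e4] at h4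
  rw [e4']
  change _ ≤ 3 * (𝔼 σ, u σ) ^ 2 at h4
  change _ ≤ 3 * (𝔼 σ, h σ) ^ 2
  have pu : ∀ σ, 0 ≤ u σ := fun σ => sq_nonneg _
  have ph : ∀ σ, 0 ≤ h σ := fun σ => sq_nonneg _
  have hu0 : 0 ≤ 𝔼 σ, u σ := expect_nonneg fun _ _ => pu _
  have hh0 : 0 ≤ 𝔼 σ, h σ := expect_nonneg fun _ _ => ph _
  have hle : ∀ σ, h σ ≤ u σ := fun σ => edgeMsg_sq_le_sq hb _
  have c1 : (𝔼 σ, h σ * h σ) * 𝔼 σ, u σ ≤ (𝔼 σ, h σ * u σ) * 𝔼 σ, h σ := by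
    have : 𝔼 σ, 𝔼 τ, (h σ - h τ) * (h σ * u τ - u σ * h τ) ≤ 0 := by
      refine (expect_le_expect fun σ _ => expect_le_expect fun τ _ =>
        (edgeMsg_sq_order hb (X σ) (X τ)).1).trans ?_
      simp
    have e : 𝔼 σ, 𝔼 τ, (h σ - h τ) * (h σ * u τ - u σ * h τ) =
        2 * ((𝔼 σ, h σ * h σ) * 𝔼 σ, u σ) - 2 * ((𝔼 σ, h σ * u σ) * 𝔼 σ, h σ) := by
      have e0 : ∀ σ, 𝔼 τ, (h σ - h τ) * (h σ * u τ - u σ * h τ) =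
          h σ * h σ * (𝔼 τ, u τ) - h σ * u σ * (𝔼 τ, h τ) - h σ * (𝔼 τ, h τ * u τ)
            + u σ * 𝔼 τ, h τ * h τ := fun σ => by
        simp only [mul_expect, ← expect_sub_distrib, ← expect_add_distrib]
        exact expect_congr rfl fun _ _ => by ring
      simp only [e0, expect_add_distrib, expect_sub_distrib, ← expect_mul]
      ring
    linarith
  have c2 : (𝔼 σ, h σ * u σ) * 𝔼 σ, u σ ≤ (𝔼 σ, u σ * u σ) * 𝔼 σ, h σ := by
    have : 𝔼 σ, 𝔼 τ, (u σ - u τ) * (h σ * u τ - u σ * h τ) ≤ 0 := by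
      refine (expect_le_expect fun σ _ => expect_le_expect fun τ _ =>
        (edgeMsg_sq_order hb (X σ) (X τ)).2).trans ?_
      simp
    have e : 𝔼 σ, 𝔼 τ, (u σ - u τ) * (h σ * u τ - u σ * h τ) =
        2 * ((𝔼 σ, h σ * u σ) * 𝔼 σ, u σ) - 2 * ((𝔼 σ, u σ * u σ) * 𝔼 σ, h σ) := by
      have e0 : ∀ σ, 𝔼 τ, (u σ - u τ) * (h σ * u τ - u σ * h τ) =
          h σ * u σ * (𝔼 τ, u τ) - u σ * u σ * (𝔼 τ, h τ) - h σ * (𝔼 τ, u τ * u τ)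
            + u σ * 𝔼 τ, h τ * u τ := fun σ => by
        simp only [mul_expect, ← expect_sub_distrib, ← expect_add_distrib]
        exact expect_congr rfl fun _ _ => by ring
      simp only [e0, expect_add_distrib, expect_sub_distrib, ← expect_mul]
      ring
    linarith
  rcases hu0.eq_or_lt with h0 | h0
  · rw [← h0] at h4
    have : 𝔼 σ, h σ * h σ ≤ 𝔼 σ, u σ * u σ := expect_le_expect fun σ _ =>
      mul_le_mul (hle σ) (hle σ) (ph σ) (pu σ)
    nlinarith
  · have c3 := mul_le_mul_of_nonneg_right c1 hu0
    have c4 := mul_le_mul_of_nonneg_right c2 hh0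
    have c5 := mul_le_mul_of_nonneg_right h4 (mul_nonneg hh0 hh0)
    refine le_of_mul_le_mul_right ?_ (mul_pos h0 h0)
    nlinarith

/-- Second and fourth moments of sums of centred variables, from factorization of the mixed
moments of each summand with the preceding partial sum. -/
lemma moments_sum_range (W : ℕ → Ω → ℝ) (n : ℕ)
    (hind : ∀ i < n, ∀ a d : ℕ, 𝔼 σ, (∑ j ∈ range i, W j σ) ^ a * W i σ ^ d =
      (𝔼 σ, (∑ j ∈ range i, W j σ) ^ a) * 𝔼 σ, W i σ ^ d)
    (h1 : ∀ i < n, 𝔼 σ, W i σ = 0) (h3 : ∀ i < n, 𝔼 σ, W i σ ^ 3 = 0)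
    (h4 : ∀ i < n, 𝔼 σ, W i σ ^ 4 ≤ 3 * (𝔼 σ, W i σ ^ 2) ^ 2) :
    𝔼 σ, (∑ j ∈ range n, W j σ) ^ 2 = ∑ j ∈ range n, 𝔼 σ, W j σ ^ 2 ∧
    𝔼 σ, (∑ j ∈ range n, W j σ) ^ 4 ≤ 3 * (𝔼 σ, (∑ j ∈ range n, W j σ) ^ 2) ^ 2 := by
  induction n with
  | zero => simp
  | succ n ih =>
    obtain ⟨i2, i4⟩ := ih (fun i hi => hind i (by omega)) (fun i hi => h1 i (by omega))
      (fun i hi => h3 i (by omega)) (fun i hi => h4 i (by omega))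
    have hi := hind n (by omega)
    have k1 : 𝔼 σ, W n σ ^ 1 = 0 := by simpa using h1 n (by omega)
    have k3 := h3 n (by omega)
    have k4 := h4 n (by omega)
    have e2 : 𝔼 σ, (∑ j ∈ range (n + 1), W j σ) ^ 2 =
        𝔼 σ, (∑ j ∈ range n, W j σ) ^ 2 + 𝔼 σ, W n σ ^ 2 := by
      have := hi 1 1
      rw [k1, mul_zero] at this
      have e : ∀ σ, (∑ j ∈ range (n + 1), W j σ) ^ 2 = (∑ j ∈ range n, W j σ) ^ 2 +
          2 * ((∑ j ∈ range n, W j σ) ^ 1 * W n σ ^ 1) + W n σ ^ 2 := fun σ => by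
        rw [sum_range_succ]; ring
      simp only [e, expect_add_distrib, ← mul_expect, this]
      ring
    have e4 : 𝔼 σ, (∑ j ∈ range (n + 1), W j σ) ^ 4 =
        𝔼 σ, (∑ j ∈ range n, W j σ) ^ 4 +
          6 * ((𝔼 σ, (∑ j ∈ range n, W j σ) ^ 2) * 𝔼 σ, W n σ ^ 2) + 𝔼 σ, W n σ ^ 4 := by
      have e : ∀ σ, (∑ j ∈ range (n + 1), W j σ) ^ 4 = (∑ j ∈ range n, W j σ) ^ 4 +
          4 * ((∑ j ∈ range n, W j σ) ^ 3 * W n σ ^ 1) +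
          6 * ((∑ j ∈ range n, W j σ) ^ 2 * W n σ ^ 2) +
          4 * ((∑ j ∈ range n, W j σ) ^ 1 * W n σ ^ 3) + W n σ ^ 4 := fun σ => by
        rw [sum_range_succ]; ring
      simp only [e, expect_add_distrib, ← mul_expect, hi, k1, k3]
      ring
    refine ⟨by rw [e2, i2, sum_range_succ], ?_⟩
    rw [e4, e2]
    nlinarith

/-- Functions of the spins inside and outside a set of sites are uncorrelated under the uniform
measure. -/
lemma expect_mul_of_disjoint_support {ι : Type*} [inst : Fintype (ι → Bool)] (p : ι → Prop)
    (F G : (ι → Bool) → ℝ)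
    (hF : ∀ σ τ : ι → Bool, (∀ x, ¬ p x → σ x = τ x) → F σ = F τ)
    (hG : ∀ σ τ : ι → Bool, (∀ x, p x → σ x = τ x) → G σ = G τ) :
    𝔼 σ, F σ * G σ = (𝔼 σ, F σ) * 𝔼 σ, G σ := by
  let sp : (ι → Bool) → (ι → Bool) → (ι → Bool) := fun σ τ x => if p x then τ x else σ x
  let e : (ι → Bool) × (ι → Bool) → (ι → Bool) × (ι → Bool) := fun q => (sp q.1 q.2, sp q.2 q.1)
  have he : Function.Involutive e := by
    rintro ⟨σ, τ⟩
    ext x <;> simp only [e, sp] <;> split_ifs <;> rfl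
  have h1 : 𝔼 q : (ι → Bool) × (ι → Bool), F q.1 * G q.2 = (𝔼 σ, F σ) * 𝔼 σ, G σ := by
    rw [Fintype.expect_mul_expect, ← univ_product_univ, expect_product]
  have h2 : 𝔼 q : (ι → Bool) × (ι → Bool), F q.1 * G q.1 = 𝔼 σ, F σ * G σ := by
    rw [← univ_product_univ, expect_product]
    simp
  rw [← h1, ← h2]
  refine (Fintype.expect_equiv he.toPerm _ _ fun q => ?_).symm
  change F q.1 * G q.2 = F (sp q.1 q.2) * G (sp q.1 q.2)
  congr 1
  · exact hF _ _ fun x hx => by simp [sp, hx]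
  · exact hG _ _ fun x hx => by simp [sp, hx]

end Moments

lemma IsVtx.dropLast {c : Vtx → ℕ} {v : Vtx} (h : IsVtx c v) : IsVtx c v.dropLast := by
  cases h with
  | root => exact .root
  | child h _ => simpa using h

lemma isVtx_append_singleton {c : Vtx → ℕ} {v : Vtx} {i : ℕ} :
    IsVtx c (v ++ [i]) ↔ IsVtx c v ∧ i < c v := by
  refine ⟨fun h => ?_, fun h => .child h.1 h.2⟩
  generalize hw : v ++ [i] = w at h
  cases h with
  | root => simp at hw
  | child h h' =>
    obtain ⟨rfl, h2⟩ := List.append_inj' hw rfl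
    simp only [List.cons.injEq, and_true] at h2
    exact ⟨h, h2 ▸ h'⟩

lemma IsVtx.of_prefix {c : Vtx → ℕ} {v w : Vtx} (hw : IsVtx c w) (h : v <+: w) : IsVtx c v := by
  induction hw with
  | root => rw [List.prefix_nil.1 h]; exact .root
  | child hv hi ih =>
    rcases List.prefix_concat_iff.1 h with rfl | h
    · exact .child hv hi
    · exact ih h

lemma mem_lev {c : Vtx → ℕ} {n : ℕ} {v : Vtx} : v ∈ lev c n ↔ IsVtx c v ∧ v.length = n := by
  induction n generalizing v with
  | zero =>
    simp only [lev, Finset.mem_singleton, List.length_eq_zero_iff]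
    exact ⟨fun h => ⟨h ▸ .root, h⟩, fun h => h.2⟩
  | succ n ih =>
    simp only [lev, Finset.mem_biUnion, Finset.mem_image, Finset.mem_range, ih]
    constructor
    · rintro ⟨u, ⟨hu, rfl⟩, i, hi, rfl⟩
      exact ⟨.child hu hi, by simp⟩
    · rintro ⟨hv, hl⟩
      cases hv with
      | root => simp at hl
      | @child u i hu hi => exact ⟨u, ⟨hu, by simpa using hl⟩, i, hi, rfl⟩

lemma mem_verts {c : Vtx → ℕ} {N : ℕ} {v : Vtx} : v ∈ verts c N ↔ IsVtx c v ∧ v.length ≤ N := by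
  simp only [verts, Finset.mem_biUnion, Finset.mem_range, mem_lev]
  exact ⟨fun ⟨n, hn, hv, hl⟩ => ⟨hv, by omega⟩, fun ⟨hv, hl⟩ => ⟨_, by omega, hv, rfl⟩⟩

lemma prod_lev_succ (c : Vtx → ℕ) (n : ℕ) (F : Vtx → ℝ) :
    ∏ x ∈ lev c (n + 1), F x = ∏ v ∈ lev c n, ∏ i ∈ Finset.range (c v), F (v ++ [i]) := by
  rw [lev, Finset.prod_biUnion]
  · refine Finset.prod_congr rfl fun v _ => Finset.prod_image fun i _ j _ h => ?_
    simpa using h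
  · intro u _ v _ huv
    refine Finset.disjoint_left.2 fun x hx hy => huv ?_
    simp only [Finset.mem_image] at hx hy
    obtain ⟨i, -, rfl⟩ := hx
    obtain ⟨j, -, h⟩ := hy
    exact (List.append_inj' h rfl).1.symm

/-- The sign `±1` of a boolean spin. -/
def boolSign (b : Bool) : ℝ := if b then 1 else -1

lemma spin_of_mem {c : Vtx → ℕ} {N : ℕ} (σ : Conf c N) {w : Vtx} (h : w ∈ verts c N) :
    spin c N σ w = boolSign (σ ⟨w, h⟩) := by
  simp [spin, h, boolSign]

lemma boolSign_injective : Function.Injective boolSign := by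
  intro a b
  cases a <;> cases b <;> simp [boolSign] <;> norm_num

lemma spin_eq {c : Vtx → ℕ} {N : ℕ} (σ : Conf c N) (w : Vtx) :
    spin c N σ w = 1 ∨ spin c N σ w = -1 := by
  unfold spin
  split_ifs <;> simp

/-- Configurations on `T^(n+1)` are configurations on `T^(n)` together with spins on the last
level. -/
def confSucc (c : Vtx → ℕ) (n : ℕ) :
    Conf c n × ({x // x ∈ lev c (n + 1)} → Bool) ≃ Conf c (n + 1) where
  toFun q x := if h : x.1 ∈ verts c n then q.1 ⟨x.1, h⟩ else
    q.2 ⟨x.1, by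
      have h1 := mem_verts.1 x.2
      rw [mem_verts] at h
      refine mem_lev.2 ⟨h1.1, ?_⟩
      have : ¬ x.1.length ≤ n := fun h' => h ⟨h1.1, h'⟩
      omega⟩
  invFun τ := (fun x => τ ⟨x.1, by
      have := mem_verts.1 x.2
      exact mem_verts.2 ⟨this.1, by omega⟩⟩,
    fun x => τ ⟨x.1, by
      have := mem_lev.1 x.2
      exact mem_verts.2 ⟨this.1, this.2.le⟩⟩)
  left_inv := by
    rintro ⟨τ, ρ⟩
    refine Prod.ext (funext fun x => ?_) (funext fun x => ?_)
    · simp [x.2]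
    · have h : x.1 ∉ verts c n := fun h => by
        have h1 := (mem_verts.1 h).2
        have h2 := (mem_lev.1 x.2).2
        omega
      simp [h]
  right_inv τ := by
    refine funext fun x => ?_
    dsimp only
    split_ifs <;> rfl

lemma spin_confSucc_of_mem_verts {c : Vtx → ℕ} {n : ℕ} (τ : Conf c n)
    (ρ : {x // x ∈ lev c (n + 1)} → Bool) {x : Vtx} (h : x ∈ verts c n) :
    spin c (n + 1) (confSucc c n (τ, ρ)) x = spin c n τ x := by
  have h1 := mem_verts.1 h
  have h' : x ∈ verts c (n + 1) := mem_verts.2 ⟨h1.1, by omega⟩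
  rw [spin_of_mem _ h, spin_of_mem _ h']
  exact congrArg boolSign (dif_pos h)

lemma spin_confSucc_of_mem_lev {c : Vtx → ℕ} {n : ℕ} (τ : Conf c n)
    (ρ : {x // x ∈ lev c (n + 1)} → Bool) (x : {x // x ∈ lev c (n + 1)}) :
    spin c (n + 1) (confSucc c n (τ, ρ)) x = boolSign (ρ x) := by
  have h1 := mem_lev.1 x.2
  have h' : x.1 ∈ verts c (n + 1) := mem_verts.2 ⟨h1.1, by omega⟩
  have h : x.1 ∉ verts c n := fun h => by
    have h2 := (mem_verts.1 h).2
    omega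
  rw [spin_of_mem _ h']
  exact congrArg boolSign (dif_neg h)

lemma dropLast_mem_verts {c : Vtx → ℕ} {n : ℕ} {x : Vtx} (h : x ∈ lev c (n + 1)) :
    x.dropLast ∈ verts c n := by
  have h := mem_lev.1 h
  exact mem_verts.2 ⟨h.1.dropLast, by simp; omega⟩

lemma wt_confSucc (c : Vtx → ℕ) (J : Vtx → ℝ) (β : ℝ) (n : ℕ) (τ : Conf c n)
    (ρ : {x // x ∈ lev c (n + 1)} → Bool) :
    wt c J β (n + 1) (confSucc c n (τ, ρ)) = wt c J β n τ *
      ∏ x : {x // x ∈ lev c (n + 1)},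
        Real.exp (β * J x * spin c n τ x.1.dropLast * boolSign (ρ x)) := by
  have hd : Disjoint (lev c (n + 1)) ((Finset.range n).biUnion fun k => lev c (k + 1)) := by
    refine Finset.disjoint_left.2 fun x hx hy => ?_
    simp only [Finset.mem_biUnion, Finset.mem_range, mem_lev] at hx hy
    obtain ⟨k, hk, -, h⟩ := hy
    omega
  unfold wt
  rw [Finset.range_add_one, Finset.biUnion_insert, Finset.prod_union hd, mul_comm]
  congr 1
  · refine Finset.prod_congr rfl fun x hx => ?_
    simp only [Finset.mem_biUnion, Finset.mem_range] at hx
    obtain ⟨k, hk, hx⟩ := hx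
    have h1 := mem_verts.1 (dropLast_mem_verts hx)
    have h2 := mem_lev.1 hx
    rw [spin_confSucc_of_mem_verts _ _ (mem_verts.2 ⟨h1.1, by omega⟩),
      spin_confSucc_of_mem_verts _ _ (mem_verts.2 ⟨h2.1, by omega⟩)]
  · rw [← Finset.prod_coe_sort]
    refine Finset.prod_congr rfl fun x _ => ?_
    rw [spin_confSucc_of_mem_verts _ _ (dropLast_mem_verts x.2), spin_confSucc_of_mem_lev]

/-- Summing out the spins of the last level. -/
lemma sum_conf_succ (c : Vtx → ℕ) (J : Vtx → ℝ) (β : ℝ) (n : ℕ) (s : ℝ) (ψ : Vtx → ℝ → ℝ) :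
    ∑ τ : Conf c (n + 1), (if spin c (n + 1) τ [] = s then
        wt c J β (n + 1) τ * ∏ x ∈ lev c (n + 1), ψ x (spin c (n + 1) τ x) else 0) =
    ∑ τ : Conf c n, if spin c n τ [] = s then wt c J β n τ * ∏ x ∈ lev c (n + 1),
      (Real.exp (β * J x * spin c n τ x.dropLast) * ψ x 1 +
        Real.exp (-(β * J x * spin c n τ x.dropLast)) * ψ x (-1)) else 0 := by
  rw [← (confSucc c n).sum_comp, Fintype.sum_prod_type]
  refine Finset.sum_congr rfl fun τ _ => ?_
  have h0 : ([] : Vtx) ∈ verts c n := mem_verts.2 ⟨.root, by simp⟩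
  simp only [spin_confSucc_of_mem_verts _ _ h0]
  split_ifs
  swap
  · simp
  simp only [wt_confSucc, mul_assoc, ← Finset.mul_sum]
  congr 1
  rw [← Finset.prod_coe_sort (lev c (n + 1))]
  have e : ∀ x : {x // x ∈ lev c (n + 1)},
      Real.exp (β * (J x * spin c n τ x.1.dropLast)) * ψ x 1 +
        Real.exp (-(β * (J x * spin c n τ x.1.dropLast))) * ψ x (-1) =
      ∑ b : Bool, Real.exp (β * (J x * (spin c n τ x.1.dropLast * boolSign b))) *
        ψ x (boolSign b) := fun x => by
    simp [boolSign]
  simp only [e]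
  rw [Finset.prod_univ_sum, Fintype.piFinset_univ]
  refine Finset.sum_congr rfl fun ρ _ => ?_
  rw [← Finset.prod_coe_sort (lev c (n + 1)), ← Finset.prod_mul_distrib]
  simp only [spin_confSucc_of_mem_lev]

/-- The partition function on `T^(n)` with root spin `s` and external field `h / 2` on the last
level. -/
def fieldSum (c : Vtx → ℕ) (J : Vtx → ℝ) (β : ℝ) (n : ℕ) (h : Vtx → ℝ) (s : ℝ) : ℝ :=
  ∑ τ : Conf c n, if spin c n τ [] = s then
    wt c J β n τ * ∏ x ∈ lev c n, Real.exp (h x / 2 * spin c n τ x) else 0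

/-- One step of the recursion for log-likelihood ratios. -/
def fieldUp (c : Vtx → ℕ) (J : Vtx → ℝ) (β : ℝ) (h : Vtx → ℝ) (v : Vtx) : ℝ :=
  ∑ i ∈ Finset.range (c v), edgeMsg (β * J (v ++ [i])) (h (v ++ [i]))

lemma exp_add_exp_eq (b h a : ℝ) (ha : a = 1 ∨ a = -1) :
    Real.exp (b * a) * Real.exp (h / 2 * 1) + Real.exp (-(b * a)) * Real.exp (h / 2 * -1) =
      2 * Real.cosh (b + h / 2) * Real.exp (-(edgeMsg b h / 2)) *
        Real.exp (edgeMsg b h / 2 * a) := by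
  rw [mul_assoc, ← Real.exp_add, ← Real.exp_add, ← Real.exp_add]
  rcases ha with rfl | rfl
  · rw [show -(edgeMsg b h / 2) + edgeMsg b h / 2 * 1 = 0 by ring, Real.exp_zero, Real.cosh_eq]
    ring_nf
  · rw [show -(edgeMsg b h / 2) + edgeMsg b h / 2 * -1 = -edgeMsg b h by ring, Real.exp_neg,
      edgeMsg, Real.exp_log (div_pos (Real.cosh_pos _) (Real.cosh_pos _)), inv_div, mul_assoc,
      mul_div_cancel₀ _ (Real.cosh_pos _).ne', Real.cosh_eq]
    ring_nf

lemma prod_lev_succ_exp (c : Vtx → ℕ) (n : ℕ) (f : Vtx → ℝ) (s : Vtx → ℝ) :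
    ∏ x ∈ lev c (n + 1), Real.exp (f x / 2 * s x.dropLast) =
      ∏ v ∈ lev c n, Real.exp ((∑ i ∈ Finset.range (c v), f (v ++ [i])) / 2 * s v) := by
  rw [prod_lev_succ]
  refine Finset.prod_congr rfl fun v _ => ?_
  rw [← Real.exp_sum, Finset.sum_div, Finset.sum_mul]
  simp

lemma fieldSum_succ (c : Vtx → ℕ) (J : Vtx → ℝ) (β : ℝ) (n : ℕ) (h : Vtx → ℝ) :
    ∃ A : ℝ, 0 < A ∧ ∀ s, fieldSum c J β (n + 1) h s =
      A * fieldSum c J β n (fieldUp c J β h) s := by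
  refine ⟨∏ x ∈ lev c (n + 1), 2 * Real.cosh (β * J x + h x / 2) *
    Real.exp (-(edgeMsg (β * J x) (h x) / 2)), Finset.prod_pos fun x _ => by
      have := Real.cosh_pos (β * J x + h x / 2)
      positivity, fun s => ?_⟩
  unfold fieldSum
  rw [sum_conf_succ c J β n s (fun x t => Real.exp (h x / 2 * t)), Finset.mul_sum]
  refine Finset.sum_congr rfl fun τ _ => ?_
  split_ifs
  swap
  · simp
  rw [mul_left_comm]
  congr 1
  rw [Finset.prod_congr rfl fun x _ => exp_add_exp_eq _ _ _ (spin_eq τ x.dropLast),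
    Finset.prod_mul_distrib, prod_lev_succ_exp c n (fun x => edgeMsg (β * J x) (h x))]
  rfl

/-- The contribution of the subtree at `w` of depth `k` to the log-likelihood ratio of the parent
of `w`, given the spins `ξ`. -/
def msg (c : Vtx → ℕ) (J : Vtx → ℝ) (β : ℝ) (ξ : Vtx → ℝ) : ℕ → Vtx → ℝ
  | 0, w => 2 * (β * J w) * ξ w
  | k + 1, w => edgeMsg (β * J w) (∑ i ∈ Finset.range (c w), msg c J β ξ k (w ++ [i]))

lemma log_fieldSum_div (c : Vtx → ℕ) (J : Vtx → ℝ) (β : ℝ) (ξ : Vtx → ℝ) (n k : ℕ) :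
    Real.log (fieldSum c J β n
        (fun v => ∑ i ∈ Finset.range (c v), msg c J β ξ k (v ++ [i])) 1 /
      fieldSum c J β n (fun v => ∑ i ∈ Finset.range (c v), msg c J β ξ k (v ++ [i])) (-1)) =
    ∑ i ∈ Finset.range (c []), msg c J β ξ (k + n) [i] := by
  induction n generalizing k with
  | zero =>
    have h0 : ([] : Vtx) ∈ verts c 0 := mem_verts.2 ⟨.root, by simp⟩
    have key : ∀ (h : Vtx → ℝ) (b : Bool),
        fieldSum c J β 0 h (boolSign b) = Real.exp (h [] / 2 * boolSign b) := fun h b => by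
      have huniq : ∀ x : {v // v ∈ verts c 0}, x = ⟨[], h0⟩ := fun x => Subtype.ext
        (List.length_eq_zero_iff.1 (Nat.le_zero.1 (mem_verts.1 x.2).2))
      unfold fieldSum
      let σ : Conf c 0 := fun _ => b
      have hσ : spin c 0 σ [] = boolSign b := spin_of_mem σ h0
      refine (Fintype.sum_eq_single σ fun τ hτ => ?_).trans ?_
      · refine if_neg fun h' => hτ ?_
        rw [spin_of_mem _ h0] at h'
        funext x
        rw [huniq x]
        exact boolSign_injective h'
      · rw [if_pos hσ]
        simp [wt, lev, hσ]
    have h1 := key (fun v => ∑ i ∈ Finset.range (c v), msg c J β ξ k (v ++ [i])) true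
    have h2 := key (fun v => ∑ i ∈ Finset.range (c v), msg c J β ξ k (v ++ [i])) false
    simp only [boolSign, if_true, Bool.false_eq_true, if_false] at h1 h2
    rw [h1, h2, ← Real.exp_sub, Real.log_exp]
    simp
  | succ n ih =>
    obtain ⟨A, hA, h⟩ := fieldSum_succ c J β n
      (fun v => ∑ i ∈ Finset.range (c v), msg c J β ξ k (v ++ [i]))
    rw [h, h, mul_div_mul_left _ _ hA.ne', show k + (n + 1) = k + 1 + n by ring]
    exact ih (k + 1)

/-- The log-likelihood ratio at the root is the sum of the messages from its children. -/
lemma XoOf_succ (c : Vtx → ℕ) (J : Vtx → ℝ) (β : ℝ) (n : ℕ) (σ : Conf c (n + 1)) :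
    XoOf c J β (n + 1) σ =
      ∑ i ∈ Finset.range (c []), msg c J β (spin c (n + 1) σ) n [i] := by
  have hagree : ∀ τ : Conf c (n + 1),
      (∀ x : {v // v ∈ verts c (n + 1)}, x.1 ∈ lev c (n + 1) → τ x = σ x) ↔
      ∀ x ∈ lev c (n + 1), spin c (n + 1) τ x = spin c (n + 1) σ x := fun τ => by
    refine ⟨fun h x hx => ?_, fun h x hx => ?_⟩
    · have hx' : x ∈ verts c (n + 1) := mem_verts.2 ⟨(mem_lev.1 hx).1, (mem_lev.1 hx).2.le⟩
      rw [spin_of_mem _ hx', spin_of_mem _ hx', h ⟨x, hx'⟩ hx]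
    · have := h x hx
      rw [spin_of_mem _ x.2, spin_of_mem _ x.2] at this
      exact boolSign_injective this
  have key : ∀ s : ℝ, (∑ τ : Conf c (n + 1),
      if (∀ x : {v // v ∈ verts c (n + 1)}, x.1 ∈ lev c (n + 1) → τ x = σ x)
        ∧ spin c (n + 1) τ [] = s then wt c J β (n + 1) τ else 0) =
      fieldSum c J β n (fun v => ∑ i ∈ Finset.range (c v),
        msg c J β (spin c (n + 1) σ) 0 (v ++ [i])) s := fun s => by
    have e : ∀ τ : Conf c (n + 1),
        (if (∀ x : {v // v ∈ verts c (n + 1)}, x.1 ∈ lev c (n + 1) → τ x = σ x)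
          ∧ spin c (n + 1) τ [] = s then wt c J β (n + 1) τ else 0) =
        if spin c (n + 1) τ [] = s then wt c J β (n + 1) τ * ∏ x ∈ lev c (n + 1),
          (fun x t => if t = spin c (n + 1) σ x then (1 : ℝ) else 0) x (spin c (n + 1) τ x)
        else 0 := fun τ => by
      refine (if_congr ((and_congr_left' (hagree τ)).trans and_comm) rfl rfl).trans ?_
      rw [ite_and]
      refine if_congr Iff.rfl ?_ rfl
      rw [Finset.prod_ite_zero]
      split_ifs <;> simp
    rw [Finset.sum_congr rfl fun τ _ => e τ, sum_conf_succ c J β n s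
      (fun x t => if t = spin c (n + 1) σ x then (1 : ℝ) else 0), fieldSum]
    refine Finset.sum_congr rfl fun τ _ => if_congr Iff.rfl ?_ rfl
    congr 1
    rw [← prod_lev_succ_exp c n (fun x => msg c J β (spin c (n + 1) σ) 0 x)]
    refine Finset.prod_congr rfl fun x _ => ?_
    rcases spin_eq σ x with h | h <;> (rw [msg, h]; norm_num; try ring_nf)
  rw [XoOf, key, key, log_fieldSum_div, zero_add]

section Messages

open Finset BigOperators

lemma msg_congr {c : Vtx → ℕ} {J : Vtx → ℝ} {β : ℝ} {ξ ξ' : Vtx → ℝ} {k : ℕ} {w : Vtx}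
    (hw : IsVtx c w)
    (h : ∀ x, IsVtx c x → w <+: x → x.length = w.length + k → ξ x = ξ' x) :
    msg c J β ξ k w = msg c J β ξ' k w := by
  induction k generalizing w with
  | zero => rw [msg, msg, h w hw (List.prefix_refl w) (by simp)]
  | succ k ih =>
    rw [msg, msg]
    congr 1
    refine sum_congr rfl fun i hi => ih (.child hw (mem_range.1 hi)) fun x hx hp hl => ?_
    exact h x hx ((List.prefix_append _ _).trans hp) (by simp at hl; omega)

lemma msg_neg {c : Vtx → ℕ} {J : Vtx → ℝ} {β : ℝ} {ξ ξ' : Vtx → ℝ} {k : ℕ} {w : Vtx}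
    (hw : IsVtx c w)
    (h : ∀ x, IsVtx c x → w <+: x → x.length = w.length + k → ξ' x = -ξ x) :
    msg c J β ξ' k w = -msg c J β ξ k w := by
  induction k generalizing w with
  | zero => rw [msg, msg, h w hw (List.prefix_refl w) (by simp), mul_neg]
  | succ k ih =>
    rw [msg, msg, ← edgeMsg_neg, ← sum_neg_distrib]
    congr 1
    refine sum_congr rfl fun i hi => ih (.child hw (mem_range.1 hi)) fun x hx hp hl => ?_
    exact h x hx ((List.prefix_append _ _).trans hp) (by simp at hl; omega)

lemma abs_msg_spin_le {c : Vtx → ℕ} {J : Vtx → ℝ} {β : ℝ} {N : ℕ} (σ : Conf c N) (k : ℕ) {w : Vtx}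
    (hb : 0 < β * J w) : |msg c J β (spin c N σ) k w| ≤ 2 * (β * J w) := by
  cases k with
  | zero =>
    rw [msg]
    have h2 : 0 ≤ 2 * (β * J w) := by linarith
    rcases spin_eq σ w with h | h <;> rw [h] <;> simp [abs_of_pos hb]
  | succ k => exact edgeMsg_abs_le hb _

instance (c : Vtx → ℕ) (N : ℕ) : Nonempty (Conf c N) := ⟨fun _ => true⟩

lemma expect_msg_pow_odd {c : Vtx → ℕ} {J : Vtx → ℝ} {β : ℝ} {N k : ℕ} {w : Vtx}
    (hw : IsVtx c w) (hN : w.length + k = N) {m : ℕ} (hm : Odd m) :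
    𝔼 σ : Conf c N, msg c J β (spin c N σ) k w ^ m = 0 := by
  let flip : Conf c N → Conf c N := fun σ x => !(σ x)
  have hflip : Function.Involutive flip := fun σ => funext fun x => Bool.not_not (σ x)
  have h : 𝔼 σ : Conf c N, msg c J β (spin c N σ) k w ^ m =
      𝔼 σ : Conf c N, -msg c J β (spin c N σ) k w ^ m := by
    refine Fintype.expect_equiv hflip.toPerm _ _ fun σ => ?_
    rw [← hm.neg_pow]
    congr 1
    refine msg_neg hw fun x hx hp hl => ?_
    have hx' : x ∈ verts c N := mem_verts.2 ⟨hx, by omega⟩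
    rw [spin_of_mem _ hx', spin_of_mem _ hx']
    change boolSign (σ ⟨x, hx'⟩) = -boolSign (!(σ ⟨x, hx'⟩))
    cases σ ⟨x, hx'⟩ <;> simp [boolSign]
  rw [expect_neg_distrib] at h
  linarith

lemma expect_sum_msg_mul {c : Vtx → ℕ} {J : Vtx → ℝ} {β : ℝ} {N k : ℕ} {v : Vtx}
    (hv : IsVtx c v) {i : ℕ} (hi : i < c v) (a d : ℕ) :
    𝔼 σ : Conf c N, (∑ j ∈ range i, msg c J β (spin c N σ) k (v ++ [j])) ^ a *
        msg c J β (spin c N σ) k (v ++ [i]) ^ d =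
      (𝔼 σ : Conf c N, (∑ j ∈ range i, msg c J β (spin c N σ) k (v ++ [j])) ^ a) *
        𝔼 σ : Conf c N, msg c J β (spin c N σ) k (v ++ [i]) ^ d := by
  have hspin : ∀ (σ τ : Conf c N) (p : Vtx → Prop),
      (∀ x : {v // v ∈ verts c N}, p x.1 → (σ : {v // v ∈ verts c N} → Bool) x = τ x) →
      ∀ x, p x → spin c N σ x = spin c N τ x := fun σ τ p h x hx => by
    by_cases hx' : x ∈ verts c N
    · rw [spin_of_mem _ hx', spin_of_mem _ hx']
      exact congrArg boolSign (h ⟨x, hx'⟩ hx)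
    · simp [spin, hx']
  refine expect_mul_of_disjoint_support (ι := {v // v ∈ verts c N})
    (inst := inferInstanceAs (Fintype (Conf c N)))
    (fun x => v ++ [i] <+: x.1)
    (fun σ => (∑ j ∈ range i, msg c J β (spin c N σ) k (v ++ [j])) ^ a)
    (fun σ => msg c J β (spin c N σ) k (v ++ [i]) ^ d) (fun σ τ h => ?_) (fun σ τ h => ?_)
  · congr 1
    refine sum_congr rfl fun j hj => ?_
    have hj := mem_range.1 hj
    refine msg_congr (.child hv (hj.trans hi)) fun x _ hp _ =>
      hspin σ τ (fun x => ¬ v ++ [i] <+: x) h x fun hp' => ?_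
    have := (List.prefix_of_prefix_length_le hp hp' (by simp)).eq_of_length (by simp)
    simp at this
    omega
  · congr 1
    exact msg_congr (.child hv hi) fun x _ hp _ => hspin σ τ (fun x => v ++ [i] <+: x) h x hp

/-- `hitRatio c t k w` is `C / (1 + C)`, where `C` is the effective conductance from `w` to the
vertices `k` levels below it, when the edge into `u` has resistance `1 / t u` relative to the
edge into the parent of `u`. -/
def hitRatio (c : Vtx → ℕ) (t : Vtx → ℝ) : ℕ → Vtx → ℝ
  | 0, _ => 1
  | k + 1, w => (∑ i ∈ range (c w), t (w ++ [i]) * hitRatio c t k (w ++ [i])) /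
      (1 + ∑ i ∈ range (c w), t (w ++ [i]) * hitRatio c t k (w ++ [i]))

/-- The effective conductance from `v` to the vertices `k + 1` levels below it. -/
def levelCond (c : Vtx → ℕ) (t : Vtx → ℝ) (k : ℕ) (v : Vtx) : ℝ :=
  ∑ i ∈ range (c v), t (v ++ [i]) * hitRatio c t k (v ++ [i])

lemma hitRatio_succ (c : Vtx → ℕ) (t : Vtx → ℝ) (k : ℕ) (w : Vtx) :
    hitRatio c t (k + 1) w = levelCond c t k w / (1 + levelCond c t k w) := rfl

lemma div_one_add_le_div_one_add {x y : ℝ} (hx : 0 ≤ x) (hxy : x ≤ y) :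
    x / (1 + x) ≤ y / (1 + y) := by
  rw [div_le_div_iff₀ (by linarith) (by linarith)]
  linarith

/-- Comparison of the second moments of the messages with conductances. -/
lemma msg_moments {c : Vtx → ℕ} {J : Vtx → ℝ} {β M : ℝ}
    (hpos : ∀ v, IsVtx c v → v ≠ [] → 0 < β * J v)
    (hM : ∀ v, IsVtx c v → v ≠ [] → 1 + Real.cosh (2 * (β * J v)) ≤ M) {N k : ℕ} {w : Vtx}
    (hw : IsVtx c w) (hw0 : w ≠ []) (hN : w.length + k = N) :
    𝔼 σ : Conf c N, msg c J β (spin c N σ) k w ^ 4 ≤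
      3 * (𝔼 σ : Conf c N, msg c J β (spin c N σ) k w ^ 2) ^ 2 ∧
    1 / (4 * M) * 𝔼 σ : Conf c N, msg c J β (spin c N σ) k w ^ 2 ≤
      Real.tanh (β * J w) ^ 2 * hitRatio c (fun v => Real.tanh (β * J v) ^ 2) k w ∧
    Real.tanh (β * J w) ^ 2 * hitRatio c (fun v => Real.tanh (β * J v) ^ 2) k w ≤
      9 * 𝔼 σ : Conf c N, msg c J β (spin c N σ) k w ^ 2 := by
  induction k generalizing w with
  | zero =>
    have hb := hpos w hw hw0
    have h2 : ∀ σ : Conf c N, msg c J β (spin c N σ) 0 w ^ 2 = (2 * (β * J w)) ^ 2 := fun σ => by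
      rcases spin_eq σ w with h | h <;> rw [msg, h] <;> ring
    have h4 : ∀ σ : Conf c N, msg c J β (spin c N σ) 0 w ^ 4 = (2 * (β * J w)) ^ 4 := fun σ => by
      rcases spin_eq σ w with h | h <;> rw [msg, h] <;> ring
    simp only [h2, h4, Fintype.expect_const, hitRatio, mul_one]
    refine ⟨?_, le_tanh_sq hb (hM w hw hw0), tanh_sq_le hb⟩
    nlinarith [sq_nonneg ((2 * (β * J w)) ^ 2)]
  | succ k ih =>
    have hb := hpos w hw hw0
    have hc := Real.one_le_cosh (2 * (β * J w))
    have hMw := hM w hw hw0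
    have hκ : 0 < 1 / (4 * M) := by
      have : 0 < M := by linarith
      positivity
    have hch : ∀ i < c w, _ := fun i hi =>
      ih (w := w ++ [i]) (.child hw hi) (by simp) (by simp; omega)
    obtain ⟨s2, s4⟩ := moments_sum_range
      (fun i (σ : Conf c N) => msg c J β (spin c N σ) k (w ++ [i])) (c w)
      (fun i hi a d => expect_sum_msg_mul hw hi a d)
      (fun i hi => by
        simpa using expect_msg_pow_odd (J := J) (β := β) (k := k) (N := N) (.child hw hi)
          (by simp; omega) odd_one)
      (fun i hi => expect_msg_pow_odd (.child hw hi) (by simp; omega) (by decide))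
      (fun i hi => (hch i hi).1)
    have p0 : 0 ≤ 𝔼 σ : Conf c N, (∑ i ∈ range (c w), msg c J β (spin c N σ) k (w ++ [i])) ^ 2 :=
      expect_nonneg fun _ _ => sq_nonneg _
    have u1 : 1 / (4 * M) * 𝔼 σ : Conf c N,
        (∑ i ∈ range (c w), msg c J β (spin c N σ) k (w ++ [i])) ^ 2 ≤
        levelCond c (fun v => Real.tanh (β * J v) ^ 2) k w := by
      rw [s2, mul_sum]
      exact sum_le_sum fun i hi => (hch i (mem_range.1 hi)).2.1
    have u2 : levelCond c (fun v => Real.tanh (β * J v) ^ 2) k w ≤ 9 * 𝔼 σ : Conf c N,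
        (∑ i ∈ range (c w), msg c J β (spin c N σ) k (w ++ [i])) ^ 2 := by
      rw [s2, mul_sum]
      exact sum_le_sum fun i hi => (hch i (mem_range.1 hi)).2.2
    have pS : 0 ≤ levelCond c (fun v => Real.tanh (β * J v) ^ 2) k w := le_trans (by positivity) u1
    simp only [msg]
    refine ⟨edgeMsg_fourth_moment_le hb _ s4, ?_, ?_⟩
    · rw [hitRatio_succ]
      refine (mul_le_mul_of_nonneg_left (edgeMsg_second_moment_le hb hMw _) hκ.le).trans ?_
      rw [mul_left_comm, mul_div_assoc']
      exact mul_le_mul_of_nonneg_left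
        (div_one_add_le_div_one_add (by positivity) u1) (sq_nonneg _)
    · rw [hitRatio_succ]
      refine le_trans ?_ (mul_le_mul_of_nonneg_left (le_edgeMsg_second_moment hb _ s4)
        (by norm_num : (0 : ℝ) ≤ 9))
      rw [mul_left_comm (9 : ℝ), ← mul_div_assoc (9 : ℝ)]
      exact mul_le_mul_of_nonneg_left (div_one_add_le_div_one_add pS u2) (sq_nonneg _)

lemma XoOf_second_moment {c : Vtx → ℕ} {J : Vtx → ℝ} {β M : ℝ}
    (hpos : ∀ v, IsVtx c v → v ≠ [] → 0 < β * J v)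
    (hM : ∀ v, IsVtx c v → v ≠ [] → 1 + Real.cosh (2 * (β * J v)) ≤ M) (n : ℕ) :
    1 / (4 * M) * 𝔼 σ : Conf c (n + 1), XoOf c J β (n + 1) σ ^ 2 ≤
      levelCond c (fun v => Real.tanh (β * J v) ^ 2) n [] ∧
    levelCond c (fun v => Real.tanh (β * J v) ^ 2) n [] ≤
      9 * 𝔼 σ : Conf c (n + 1), XoOf c J β (n + 1) σ ^ 2 := by
  have hvx : ∀ i < c [], IsVtx c [i] := fun i hi => .child (v := []) .root hi
  have hch : ∀ i < c [], _ := fun i hi =>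
    msg_moments hpos hM (N := n + 1) (k := n) (hvx i hi) (by simp) (by simp; omega)
  obtain ⟨s2, -⟩ := moments_sum_range
    (fun i (σ : Conf c (n + 1)) => msg c J β (spin c (n + 1) σ) n [i]) (c [])
    (fun i hi a d => expect_sum_msg_mul (v := []) .root hi a d)
    (fun i hi => by
      simpa using expect_msg_pow_odd (J := J) (β := β) (k := n) (N := n + 1) (hvx i hi)
        (by simp; omega) odd_one)
    (fun i hi => expect_msg_pow_odd (hvx i hi) (by simp; omega) (by decide))
    (fun i hi => (hch i hi).1)
  simp only [XoOf_succ, s2, mul_sum, levelCond, List.nil_append]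
  exact ⟨sum_le_sum fun i hi => (hch i (mem_range.1 hi)).2.1,
    sum_le_sum fun i hi => (hch i (mem_range.1 hi)).2.2⟩

end Messages

section Capacity

open Finset Filter Topology

/-- The product of `F` over the vertices of the path from the root to `v`, root excluded. -/
def pathProd {M : Type*} [CommMonoid M] (F : Vtx → M) (v : Vtx) : M :=
  ∏ k ∈ range v.length, F (v.take (k + 1))

lemma pathProd_append {M : Type*} [CommMonoid M] (F : Vtx → M) (v : Vtx) (i : ℕ) :
    pathProd F (v ++ [i]) = pathProd F v * F (v ++ [i]) := by
  rw [pathProd, pathProd, List.length_append, List.length_singleton, prod_range_succ]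
  congr 1
  · refine prod_congr rfl fun k hk => ?_
    rw [List.take_append_of_le_length (Nat.succ_le_of_lt (mem_range.1 hk))]
  · rw [List.take_of_length_le (by simp)]

/-- Every vertex of a leafless tree lies on a ray. -/
lemma exists_ray {c : Vtx → ℕ} (hleafless : ∀ v, IsVtx c v → 1 ≤ c v) {w : Vtx} (hw : IsVtx c w) :
    ∃ y : ℕ → ℕ, IsRay c y ∧ ∀ k ≤ w.length, (List.range k).map y = w.take k := by
  let y : ℕ → ℕ := fun n => w.getD n 0
  have hy : ∀ k ≤ w.length, (List.range k).map y = w.take k := by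
    intro k hk
    refine List.ext_getElem (by simp [hk]) fun n h1 h2 => ?_
    simp only [List.length_map, List.length_range] at h1
    simp [y, List.getElem?_eq_getElem (h1.trans_le hk)]
  have hstep : ∀ n, IsVtx c ((List.range n).map y) → y n < c ((List.range n).map y) := by
    intro n hn
    by_cases h : n < w.length
    · have h1 : IsVtx c (w.take (n + 1)) := hw.of_prefix (List.take_prefix _ _)
      rw [← hy (n + 1) h, List.range_succ, List.map_append, List.map_singleton,
        isVtx_append_singleton] at h1
      exact h1.2
    · have : y n = 0 := List.getD_eq_default _ _ (not_lt.1 h)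
      rw [this]
      exact hleafless _ hn
  have hvx : ∀ n, IsVtx c ((List.range n).map y) := by
    intro n
    induction n with
    | zero => exact .root
    | succ n ih =>
      rw [List.range_succ, List.map_append, List.map_singleton]
      exact .child ih (hstep n ih)
  exact ⟨y, fun n => hstep n (hvx n), hy⟩

variable {c : Vtx → ℕ} {t : Vtx → ℝ}

lemma hitRatio_mem (ht : ∀ v, 0 ≤ t v) (k : ℕ) (w : Vtx) :
    0 ≤ hitRatio c t k w ∧ hitRatio c t k w ≤ 1 := by
  induction k generalizing w with
  | zero => simp [hitRatio]
  | succ k ih =>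
    have hS : 0 ≤ levelCond c t k w := sum_nonneg fun i _ => mul_nonneg (ht _) (ih _).1
    rw [hitRatio_succ]
    exact ⟨by positivity, (div_le_one (by positivity)).2 (by linarith)⟩

lemma levelCond_nonneg (ht : ∀ v, 0 ≤ t v) (k : ℕ) (w : Vtx) : 0 ≤ levelCond c t k w :=
  sum_nonneg fun _ _ => mul_nonneg (ht _) (hitRatio_mem ht _ _).1

lemma hitRatio_succ_le (ht : ∀ v, 0 ≤ t v) (k : ℕ) (w : Vtx) :
    hitRatio c t (k + 1) w ≤ hitRatio c t k w := by
  induction k generalizing w with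
  | zero => exact (hitRatio_mem ht 1 w).2
  | succ k ih =>
    rw [hitRatio_succ, hitRatio_succ]
    exact div_one_add_le_div_one_add (levelCond_nonneg ht _ _)
      (sum_le_sum fun i _ => mul_le_mul_of_nonneg_left (ih _) (ht _))

/-- The limit of `hitRatio` over the truncation level. -/
def hitLim (c : Vtx → ℕ) (t : Vtx → ℝ) (w : Vtx) : ℝ := ⨅ k, hitRatio c t k w

lemma tendsto_hitRatio (ht : ∀ v, 0 ≤ t v) (w : Vtx) :
    Tendsto (fun k => hitRatio c t k w) atTop (𝓝 (hitLim c t w)) :=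
  tendsto_atTop_ciInf (antitone_nat_of_succ_le fun k => hitRatio_succ_le ht k w)
    ⟨0, by rintro _ ⟨k, rfl⟩; exact (hitRatio_mem ht k w).1⟩

/-- The effective conductance from `v` to infinity. -/
def limCond (c : Vtx → ℕ) (t : Vtx → ℝ) (v : Vtx) : ℝ :=
  ∑ i ∈ range (c v), t (v ++ [i]) * hitLim c t (v ++ [i])

lemma tendsto_levelCond (ht : ∀ v, 0 ≤ t v) (v : Vtx) :
    Tendsto (fun k => levelCond c t k v) atTop (𝓝 (limCond c t v)) :=
  tendsto_finsetSum _ fun _ _ => (tendsto_hitRatio ht _).const_mul _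

lemma hitLim_mem (ht : ∀ v, 0 ≤ t v) (w : Vtx) : 0 ≤ hitLim c t w ∧ hitLim c t w ≤ 1 :=
  ⟨ge_of_tendsto' (tendsto_hitRatio ht w) fun k => (hitRatio_mem ht k w).1,
    le_of_tendsto' (tendsto_hitRatio ht w) fun k => (hitRatio_mem ht k w).2⟩

lemma limCond_nonneg (ht : ∀ v, 0 ≤ t v) (v : Vtx) : 0 ≤ limCond c t v :=
  sum_nonneg fun _ _ => mul_nonneg (ht _) (hitLim_mem ht _).1

lemma hitLim_eq (ht : ∀ v, 0 ≤ t v) (w : Vtx) :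
    hitLim c t w = limCond c t w / (1 + limCond c t w) := by
  have h1 := (tendsto_add_atTop_iff_nat 1).2 (tendsto_hitRatio (c := c) ht w)
  simp only [hitRatio_succ] at h1
  refine tendsto_nhds_unique h1 ?_
  have := limCond_nonneg (c := c) ht w
  exact (tendsto_levelCond ht w).div ((tendsto_levelCond ht w).const_add 1) (by positivity)

/-- The unit potential drop produces an admissible flow whose mass is the effective
conductance. -/
lemma limCond_le_capInf (ht : ∀ v, 0 ≤ t v) {r : Vtx → ℝ≥0∞}
    (hr : ∀ v, IsVtx c v → v ≠ [] → r v = ENNReal.ofReal (t v)) :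
    ENNReal.ofReal (limCond c t []) ≤ capInf c (fun v => (pathProd r v)⁻¹) 2 := by
  set H := hitLim c t
  have hH : ∀ w, 0 ≤ H w ∧ H w ≤ 1 := hitLim_mem ht
  set U : Vtx → ℝ := pathProd fun w => 1 - H w
  have hU : ∀ w, 0 ≤ U w := fun w => prod_nonneg fun k _ => by linarith [(hH (w.take (k + 1))).2]
  set μ : Vtx → ℝ≥0∞ := fun w => ENNReal.ofReal (U w.dropLast * H w) * pathProd r w with hμ
  have hout : ∀ v, IsVtx c v → ∑ i ∈ range (c v), μ (v ++ [i]) =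
      ENNReal.ofReal (U v * limCond c t v) * pathProd r v := by
    intro v hv
    rw [limCond, mul_sum, ENNReal.ofReal_sum_of_nonneg fun i _ =>
      mul_nonneg (hU _) (mul_nonneg (ht _) (hH _).1), sum_mul]
    refine sum_congr rfl fun i hi => ?_
    simp only [hμ, List.dropLast_concat]
    rw [pathProd_append, hr _ (.child hv (mem_range.1 hi)) (by simp), mul_comm (t _),
      ← mul_assoc (U v), ENNReal.ofReal_mul (mul_nonneg (hU _) (hH _).1)]
    ring
  refine le_sSup ⟨μ, ?_, ?_, ?_⟩
  · intro v hv hv0 _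
    rw [hout v hv]
    cases hv with
    | root => exact absurd rfl hv0
    | @child u j hu hj =>
      simp only [hμ, List.dropLast_concat]
      congr 2
      rw [show U (u ++ [j]) = U u * (1 - H (u ++ [j])) from pathProd_append _ _ _,
        show H (u ++ [j]) = _ from hitLim_eq ht _]
      have := limCond_nonneg (c := c) ht (u ++ [j])
      field_simp
      ring
  · intro y _
    rw [rayPot]
    refine ENNReal.tsum_le_of_sum_range_le fun K => ?_
    have hstep : ∀ n, (List.range (n + 1)).map y = (List.range n).map y ++ [y n] := fun n => by
      rw [List.range_succ, List.map_append, List.map_singleton]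
    calc _ ≤ ∑ n ∈ range K, ENNReal.ofReal
          (U ((List.range n).map y) - U ((List.range (n + 1)).map y)) := by
          refine sum_le_sum fun n _ => ?_
          rw [show (2 : ℝ) - 1 = 1 by norm_num, ENNReal.rpow_one, hstep]
          simp only [hμ, List.dropLast_concat]
          rw [mul_assoc, show U ((List.range n).map y ++ [y n]) = U ((List.range n).map y) *
            (1 - H ((List.range n).map y ++ [y n])) from pathProd_append _ _ _]
          refine (mul_le_of_le_one_right' (ENNReal.mul_inv_le_one _)).trans_eq ?_
          congr 1
          ring
      _ = ENNReal.ofReal (∑ n ∈ range K,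
          (U ((List.range n).map y) - U ((List.range (n + 1)).map y))) := by
          refine (ENNReal.ofReal_sum_of_nonneg fun n _ => ?_).symm
          rw [hstep, show U ((List.range n).map y ++ [y n]) = U ((List.range n).map y) *
            (1 - H ((List.range n).map y ++ [y n])) from pathProd_append _ _ _]
          nlinarith [mul_nonneg (hU ((List.range n).map y)) (hH ((List.range n).map y ++ [y n])).1]
      _ ≤ 1 := by
          rw [sum_range_sub', ENNReal.ofReal_le_one]
          have h0 : U ((List.range 0).map y) = 1 := by simp [U, pathProd]
          linarith [hU ((List.range K).map y)]
  · have := hout [] .root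
    rw [flowMass]
    simp only [List.nil_append] at this
    rw [this]
    simp [U, pathProd]

/-- An admissible flow has mass at most the effective conductance to any level. -/
lemma flowMass_le_levelCond (hleafless : ∀ v, IsVtx c v → 1 ≤ c v)
    (hpos : ∀ v, IsVtx c v → v ≠ [] → 0 < t v) (ht : ∀ v, 0 ≤ t v) {r : Vtx → ℝ≥0∞}
    (hr : ∀ v, IsVtx c v → v ≠ [] → r v = ENNReal.ofReal (t v)) {μ : Vtx → ℝ≥0∞}
    (hμ : IsFlow c μ)
    (hV : ∀ y : ℕ → ℕ, IsRay c y → rayPot μ (fun v => (pathProd r v)⁻¹) (2 - 1) y ≤ 1) (n : ℕ) :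
    flowMass c μ ≤ ENNReal.ofReal (levelCond c t n []) := by
  have hr0 : ∀ v, IsVtx c v → v ≠ [] → r v ≠ 0 := fun v hv hv0 => by
    rw [hr v hv hv0]; simpa using hpos v hv hv0
  have hrt : ∀ v, IsVtx c v → v ≠ [] → r v ≠ ∞ := fun v hv hv0 => by
    rw [hr v hv hv0]; exact ENNReal.ofReal_ne_top
  set q : Vtx → ℝ≥0∞ := fun w => μ w * (pathProd r w)⁻¹ with hq
  have hsum : ∀ w, IsVtx c w → ∑ k ∈ range w.length, q (w.take (k + 1)) ≤ 1 := by
    intro w hw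
    obtain ⟨y, hy, hyw⟩ := exists_ray hleafless hw
    refine le_trans ?_ (hV y hy)
    rw [rayPot]
    refine le_trans (le_of_eq (sum_congr rfl fun k hk => ?_)) (ENNReal.sum_le_tsum (range w.length))
    rw [show (2 : ℝ) - 1 = 1 by norm_num, ENNReal.rpow_one, hyw _ (mem_range.1 hk)]
  have hq1 : ∀ w, IsVtx c w → w ≠ [] → q w ≠ ∞ := by
    intro w hw hw0
    cases hw with
    | root => exact absurd rfl hw0
    | @child u j hu hj =>
      have := hsum _ (.child hu hj)
      rw [List.length_append, List.length_singleton, sum_range_succ,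
        List.take_of_length_le (by simp)] at this
      exact ((le_add_left le_rfl).trans this |>.trans_lt ENNReal.one_lt_top).ne
  set m : Vtx → ℝ := fun w => (q w).toReal with hm
  have hm0 : ∀ w, 0 ≤ m w := fun w => ENNReal.toReal_nonneg
  set W : Vtx → ℝ := fun w => ∑ k ∈ range w.length, m (w.take (k + 1)) with hW
  have hWapp : ∀ v i, W (v ++ [i]) = W v + m (v ++ [i]) := fun v i => by
    simp only [hW]
    rw [List.length_append, List.length_singleton, sum_range_succ,
      List.take_of_length_le (i := v.length + 1) (by simp)]
    congr 1
    refine sum_congr rfl fun k hk => ?_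
    rw [List.take_append_of_le_length (Nat.succ_le_of_lt (mem_range.1 hk))]
  have hW1 : ∀ w, IsVtx c w → W w ≤ 1 := by
    intro w hw
    have h := ENNReal.toReal_mono ENNReal.one_ne_top (hsum w hw)
    rw [ENNReal.toReal_sum, ENNReal.toReal_one] at h
    · exact h
    · intro k hk
      refine hq1 _ (hw.of_prefix (List.take_prefix _ _)) fun h0 => ?_
      have := mem_range.1 hk
      rw [List.take_eq_nil_iff] at h0
      rcases h0 with h0 | rfl
      · omega
      · simp at this
  have hP : ∀ v, IsVtx c v → pathProd r v ≠ 0 ∧ pathProd r v ≠ ∞ := by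
    intro v hv
    induction hv with
    | root => simp [pathProd]
    | @child u i hu hi ih =>
      rw [pathProd_append]
      exact ⟨mul_ne_zero ih.1 (hr0 _ (.child hu hi) (by simp)),
        ENNReal.mul_ne_top ih.2 (hrt _ (.child hu hi) (by simp))⟩
  have hchild : ∀ v i, IsVtx c v → i < c v →
      μ (v ++ [i]) * (pathProd r v)⁻¹ = ENNReal.ofReal (t (v ++ [i]) * m (v ++ [i])) := by
    intro v i hv hi
    have hvi : IsVtx c (v ++ [i]) := .child hv hi
    rw [ENNReal.ofReal_mul (ht _), ENNReal.ofReal_toReal (hq1 _ hvi (by simp)),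
      ← hr _ hvi (by simp)]
    simp only [hq]
    rw [pathProd_append, ENNReal.mul_inv (.inl (hP v hv).1) (.inl (hP v hv).2),
      mul_left_comm, mul_left_comm (r _), ENNReal.mul_inv_cancel (hr0 _ hvi (by simp))
      (hrt _ hvi (by simp)), mul_one]
  have hcons : ∀ v, IsVtx c v → v ≠ [] →
      m v = ∑ i ∈ range (c v), t (v ++ [i]) * m (v ++ [i]) := by
    intro v hv hv0
    simp only [hm]
    simp only [hq]
    rw [hμ v hv hv0 (by have := hleafless v hv; omega), sum_mul,
      sum_congr rfl fun i hi => hchild v i hv (mem_range.1 hi),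
      ← ENNReal.ofReal_sum_of_nonneg fun i _ => mul_nonneg (ht _) (hm0 _),
      ENNReal.toReal_ofReal (sum_nonneg fun i _ => mul_nonneg (ht _) (hm0 _))]
  have hbound : ∀ k v i, IsVtx c v → i < c v →
      m (v ++ [i]) ≤ (1 - W v) * hitRatio c t k (v ++ [i]) := by
    intro k
    induction k with
    | zero =>
      intro v i hv hi
      have := hW1 _ (.child hv hi)
      rw [hWapp] at this
      simp only [hitRatio]
      linarith
    | succ k ih =>
      intro v i hv hi
      have hvi : IsVtx c (v ++ [i]) := .child hv hi
      have h : m (v ++ [i]) ≤ (1 - W (v ++ [i])) * levelCond c t k (v ++ [i]) := by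
        conv_lhs => rw [hcons _ hvi (by simp)]
        rw [levelCond, mul_sum]
        refine sum_le_sum fun j hj => ?_
        rw [mul_left_comm]
        exact mul_le_mul_of_nonneg_left (ih _ j hvi (mem_range.1 hj)) (ht _)
      have hS := levelCond_nonneg (c := c) ht k (v ++ [i])
      rw [hWapp] at h
      rw [hitRatio_succ, mul_div_assoc', le_div_iff₀ (by positivity)]
      linarith
  have hroot : flowMass c μ = ∑ i ∈ range (c []), μ ([] ++ [i]) * (pathProd r [])⁻¹ := by
    simp [flowMass, pathProd]
  rw [hroot, sum_congr rfl fun i hi => hchild [] i .root (mem_range.1 hi),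
    ← ENNReal.ofReal_sum_of_nonneg fun i _ => mul_nonneg (ht _) (hm0 _)]
  refine ENNReal.ofReal_le_ofReal (sum_le_sum fun i hi =>
    mul_le_mul_of_nonneg_left ?_ (ht _))
  have := hbound n [] i .root (mem_range.1 hi)
  have h0 : W [] = 0 := by simp [hW]
  rwa [h0, sub_zero, one_mul] at this

end Capacity

section Law

open Filter Topology BigOperators

/-- Convergence in law of the root log-likelihood ratio to `0` is equivalent to vanishing of the
`2`-capacity. -/
lemma XoOf_tendsto_zero_iff (c : Vtx → ℕ) (J : Vtx → ℝ) (β Jmin Jmax : ℝ)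
    (hβ : 0 < β) (hJmin : 0 < Jmin)
    (hJ : ∀ v, IsVtx c v → v ≠ [] → Jmin ≤ J v ∧ J v ≤ Jmax)
    (hleafless : ∀ v, IsVtx c v → 1 ≤ c v) :
    (∀ f : ℝ → ℝ, Continuous f → (∃ M : ℝ, ∀ x, |f x| ≤ M) →
        Filter.Tendsto (fun N : ℕ =>
          (∑ σ : Conf c N, f (XoOf c J β N σ)) / (Fintype.card (Conf c N) : ℝ))
          Filter.atTop (nhds (f 0))) ↔
      capInf c
        (fun v => (∏ k ∈ Finset.range v.length,
          (ENNReal.ofReal (Real.tanh (β * J (v.take (k + 1))))) ^ 2)⁻¹) 2 = 0 := by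
  set t : Vtx → ℝ := fun v => Real.tanh (β * J v) ^ 2 with ht_def
  set r : Vtx → ℝ≥0∞ := fun v => ENNReal.ofReal (Real.tanh (β * J v)) ^ 2 with hr_def
  have ht : ∀ v, 0 ≤ t v := fun v => sq_nonneg _
  have hpos : ∀ v, IsVtx c v → v ≠ [] → 0 < β * J v := fun v hv hv0 =>
    mul_pos hβ (hJmin.trans_le (hJ v hv hv0).1)
  have htpos : ∀ v, IsVtx c v → v ≠ [] → 0 < t v := fun v hv hv0 =>
    pow_pos (tanh_pos (hpos v hv hv0)) 2
  have hr : ∀ v, IsVtx c v → v ≠ [] → r v = ENNReal.ofReal (t v) := fun v hv hv0 =>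
    (ENNReal.ofReal_pow (tanh_pos (hpos v hv hv0)).le 2).symm
  set M : ℝ := 1 + Real.cosh (2 * (β * Jmax)) with hM_def
  have hM0 : 0 < M := by have := Real.cosh_pos (2 * (β * Jmax)); positivity
  have hM : ∀ v, IsVtx c v → v ≠ [] → 1 + Real.cosh (2 * (β * J v)) ≤ M := fun v hv hv0 => by
    have h1 := hpos v hv hv0
    have h2 : β * J v ≤ β * Jmax := mul_le_mul_of_nonneg_left (hJ v hv hv0).2 hβ.le
    have : Real.cosh (2 * (β * J v)) ≤ Real.cosh (2 * (β * Jmax)) := by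
      rw [Real.cosh_le_cosh, abs_of_pos (by linarith), abs_of_pos (by linarith)]
      linarith
    linarith
  have hmom := XoOf_second_moment hpos hM
  have key : ∀ f : ℝ → ℝ, Tendsto (fun N : ℕ =>
          (∑ σ : Conf c N, f (XoOf c J β N σ)) / (Fintype.card (Conf c N) : ℝ)) atTop (𝓝 (f 0)) ↔
      Tendsto (fun n : ℕ => 𝔼 σ : Conf c (n + 1), f (XoOf c J β (n + 1) σ)) atTop (𝓝 (f 0)) :=
    fun f => by
      rw [← tendsto_add_atTop_iff_nat 1]
      simp only [Fintype.expect_eq_sum_div_card]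
  simp only [key]
  change _ ↔ capInf c (fun v => (pathProd r v)⁻¹) 2 = 0
  constructor
  · intro hlaw
    by_contra hcap
    have : ∃ μ : Vtx → ℝ≥0∞, IsFlow c μ ∧ (∀ y : ℕ → ℕ, IsRay c y →
        rayPot μ (fun v => (pathProd r v)⁻¹) (2 - 1) y ≤ 1) ∧ flowMass c μ ≠ 0 := by
      by_contra! h
      refine hcap (le_antisymm (sSup_le ?_) zero_le)
      rintro _ ⟨μ, h1, h2, rfl⟩
      exact (h μ h1 h2).le
    obtain ⟨μ, hflow, hV, hmass⟩ := this
    have hle := flowMass_le_levelCond hleafless htpos ht hr hflow hV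
    have hm0 : 0 < (flowMass c μ).toReal :=
      ENNReal.toReal_pos hmass ((hle 0).trans_lt ENNReal.ofReal_lt_top).ne
    have hlow : ∀ n, (flowMass c μ).toReal ≤
        9 * 𝔼 σ : Conf c (n + 1), XoOf c J β (n + 1) σ ^ 2 := fun n =>
      (ENNReal.toReal_le_of_le_ofReal (levelCond_nonneg ht n []) (hle n)).trans (hmom n).2
    set B : ℝ := ∑ i ∈ Finset.range (c []), 2 * (β * J [i])
    have hB : ∀ n (σ : Conf c (n + 1)), XoOf c J β (n + 1) σ ^ 2 ≤ B ^ 2 := fun n σ => by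
      rw [XoOf_succ, ← sq_abs]
      refine pow_le_pow_left₀ (abs_nonneg _) ((Finset.abs_sum_le_sum_abs _ _).trans
        (Finset.sum_le_sum fun i hi => abs_msg_spin_le σ n (hpos _ ?_ (by simp)))) 2
      exact .child (v := []) .root (Finset.mem_range.1 hi)
    have h := hlaw (fun x => min (x ^ 2) (B ^ 2)) (by fun_prop) ⟨B ^ 2, fun x => by
      rw [abs_of_nonneg (le_min (sq_nonneg _) (sq_nonneg _))]
      exact min_le_right _ _⟩
    simp only [min_eq_left (hB _ _), ne_eq, OfNat.ofNat_ne_zero, not_false_eq_true, zero_pow,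
      min_eq_left (sq_nonneg B)] at h
    have := ge_of_tendsto' (h.const_mul 9) hlow
    linarith
  · intro hcap f hf ⟨K, hK⟩
    have h0 : limCond c t [] = 0 := by
      have h := limCond_le_capInf ht hr
      rw [hcap, nonpos_iff_eq_zero, ENNReal.ofReal_eq_zero] at h
      exact le_antisymm h (limCond_nonneg ht _)
    have hlim := tendsto_levelCond (c := c) ht []
    rw [h0] at hlim
    have hX : Tendsto (fun n : ℕ => 𝔼 σ : Conf c (n + 1), XoOf c J β (n + 1) σ ^ 2)
        atTop (𝓝 0) := by
      refine squeeze_zero (fun n => Finset.expect_nonneg fun _ _ => sq_nonneg _) (fun n => ?_)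
        (by simpa using hlim.const_mul (4 * M))
      have := (hmom n).1
      rw [one_div_mul_eq_div, div_le_iff₀ (by positivity)] at this
      linarith
    rw [Metric.tendsto_atTop]
    intro ε hε
    obtain ⟨δ, hδ, hfδ⟩ := Metric.continuousAt_iff.1 (hf.continuousAt (x := 0)) (ε / 2)
      (half_pos hε)
    have hK0 : 0 ≤ K := (abs_nonneg _).trans (hK 0)
    have hpt : ∀ x, |f x - f 0| ≤ ε / 2 + 2 * K / δ ^ 2 * x ^ 2 := fun x => by
      rcases lt_or_ge |x| δ with h | h
      · have := hfδ (x := x) (by simpa using h)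
        rw [Real.dist_eq] at this
        have : 0 ≤ 2 * K / δ ^ 2 * x ^ 2 := by positivity
        linarith
      · have h1 : |f x - f 0| ≤ 2 * K := (abs_sub _ _).trans (by linarith [hK x, hK 0])
        have h2 : δ ^ 2 ≤ x ^ 2 := by rw [← sq_abs x]; exact pow_le_pow_left₀ hδ.le h 2
        have h3 : 2 * K ≤ 2 * K / δ ^ 2 * x ^ 2 := by
          rw [div_mul_eq_mul_div, le_div_iff₀ (by positivity)]
          exact mul_le_mul_of_nonneg_left h2 (by linarith)
        linarith
    have hsmall := (hX.const_mul (2 * K / δ ^ 2)).eventually_lt_const (u := ε / 2)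
      (by rw [mul_zero]; exact half_pos hε)
    obtain ⟨n₀, hn₀⟩ := eventually_atTop.1 hsmall
    refine ⟨n₀, fun n hn => ?_⟩
    have e : (𝔼 σ : Conf c (n + 1), f (XoOf c J β (n + 1) σ)) - f 0 =
        𝔼 σ : Conf c (n + 1), (f (XoOf c J β (n + 1) σ) - f 0) := by
      rw [Finset.expect_sub_distrib, Fintype.expect_const]
    rw [Real.dist_eq, e]
    calc _ ≤ 𝔼 σ : Conf c (n + 1), |f (XoOf c J β (n + 1) σ) - f 0| := Finset.abs_expect_le _ _
      _ ≤ 𝔼 σ : Conf c (n + 1), (ε / 2 + 2 * K / δ ^ 2 * XoOf c J β (n + 1) σ ^ 2) :=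
          Finset.expect_le_expect fun σ _ => hpt _
      _ = ε / 2 + 2 * K / δ ^ 2 * 𝔼 σ : Conf c (n + 1), XoOf c J β (n + 1) σ ^ 2 := by
          rw [Finset.expect_add_distrib, Fintype.expect_const, Finset.mul_expect]
      _ < ε := by linarith [hn₀ n hn]

end Law

/-- Under the spin-glass measure the boundary spins are i.i.d. uniform, so the expectation of
any function of `X_o^(N)` is the average of its values over all configurations.  `X_o^(N)`
converges in law to `0` iff `E f(X_o^(N)) → f(0)` for every bounded continuous `f`. -/
theorem stmt2 (c : Vtx → ℕ) (J : Vtx → ℝ) (β Jmin Jmax : ℝ)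
    (hβ : 0 < β) (hJmin : 0 < Jmin)
    (hJ : ∀ v, IsVtx c v → v ≠ [] → Jmin ≤ J v ∧ J v ≤ Jmax)
    (hleafless : ∀ v, IsVtx c v → 1 ≤ c v) :
    (∀ f : ℝ → ℝ, Continuous f → (∃ M : ℝ, ∀ x, |f x| ≤ M) →
        Filter.Tendsto (fun N : ℕ =>
          (∑ σ : Conf c N, f (XoOf c J β N σ)) / (Fintype.card (Conf c N) : ℝ))
          Filter.atTop (nhds (f 0))) ↔
      capInf c
        (fun v => (∏ k ∈ Finset.range v.length,
          (ENNReal.ofReal (Real.tanh (β * J (v.take (k + 1))))) ^ 2)⁻¹) 2 = 0 := by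
  exact XoOf_tendsto_zero_iff c J β Jmin Jmax hβ hJmin hJ hleafless
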